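/- For each extremal real number ξ there exists an unbounded admissible Fibonacci sequence (W_i)_{i≥1} in 𝒫 which is associated to ξ. -/

import Mathlib

open Matrix

/-- 2×2 integer matrices. -/
abbrev M2 : Type := Matrix (Fin 2) (Fin 2) ℤ

/-- The content of an integer matrix: the gcd of its coefficients. -/
def content (A : M2) : ℕ :=
  Nat.gcd (Nat.gcd (A 0 0).natAbs (A 0 1).natAbs) (Nat.gcd (A 1 0).natAbs (A 1 1).natAbs)

/-- A matrix is primitive if its content is 1. -/
def Primitive (A : M2) : Prop := content A = 1

/-- Membership in 𝒫: primitive with nonzero determinant. -/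
def MemP (A : M2) : Prop := Primitive A ∧ A.det ≠ 0

/-- `A^red`: the primitive matrix such that `A = content A • A^red`. -/
def red (A : M2) : M2 := Matrix.of fun i j => A i j / (content A : ℤ)

/-- The group operation of 𝒫: `A * B = (AB)^red`. -/
def pmul (A B : M2) : M2 := red (A * B)

/-- A Fibonacci sequence in 𝒫 (indices from 1). -/
def IsFibP (W : ℕ → M2) : Prop :=
  (∀ i, 1 ≤ i → MemP (W i)) ∧ ∀ i, 1 ≤ i → W (i + 2) = pmul (W (i + 1)) (W i)

/-- Admissibility of a Fibonacci sequence in 𝒫: there is a non-symmetric,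
non-skew-symmetric N ∈ 𝒫 such that W_i N_i is symmetric for all i ≥ 1,
where N_i = ᵗN for odd i and N_i = N for even i. -/
def AdmissibleFib (W : ℕ → M2) : Prop :=
  ∃ N : M2, MemP N ∧ N ≠ Nᵀ ∧ N ≠ -Nᵀ ∧
    ∀ i, 1 ≤ i → (W i * (if i % 2 = 1 then Nᵀ else N)).IsSymm

/-- The norm of an integer 2×2 matrix: max absolute value of coefficients, as a real. -/
noncomputable def mnorm (A : M2) : ℝ :=
  max (max |(A 0 0 : ℝ)| |(A 0 1 : ℝ)|) (max |(A 1 0 : ℝ)| |(A 1 1 : ℝ)|)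

/-- The sequence is unbounded in norm. -/
def UnboundedSeq (W : ℕ → M2) : Prop := ∀ C : ℝ, ∃ i, 1 ≤ i ∧ C < mnorm (W i)

/-- The golden ratio γ = (1+√5)/2. -/
noncomputable def gam : ℝ := (1 + Real.sqrt 5) / 2

/-- Norm of the row vector (ξ, -1)·A. -/
noncomputable def xiNorm (ξ : ℝ) (A : M2) : ℝ :=
  max |ξ * (A 0 0 : ℝ) - (A 1 0 : ℝ)| |ξ * (A 0 1 : ℝ) - (A 1 1 : ℝ)|

/-- ξ is extremal: neither rational nor quadratic over ℚ, and for each X ≥ 1 the system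
|x₀| ≤ X, |x₀ξ - x₁| ≤ c X^(-1/γ), |x₀ξ² - x₂| ≤ c X^(-1/γ) has a nonzero integer solution. -/
def IsExtremal (ξ : ℝ) : Prop :=
  (∀ a b c : ℚ, ¬(a = 0 ∧ b = 0 ∧ c = 0) → (a : ℝ) * ξ ^ 2 + (b : ℝ) * ξ + (c : ℝ) ≠ 0) ∧
  ∃ c : ℝ, 0 < c ∧ ∀ X : ℝ, 1 ≤ X → ∃ x₀ x₁ x₂ : ℤ,
    ¬(x₀ = 0 ∧ x₁ = 0 ∧ x₂ = 0) ∧ |(x₀ : ℝ)| ≤ X ∧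
    |(x₀ : ℝ) * ξ - (x₁ : ℝ)| ≤ c * X ^ (-1 / gam) ∧
    |(x₀ : ℝ) * ξ ^ 2 - (x₂ : ℝ)| ≤ c * X ^ (-1 / gam)

/-- The Fibonacci sequence `W` in 𝒫 is associated to the extremal real number ξ:
it is an unbounded admissible Fibonacci sequence in 𝒫 with
‖W_{i+1}‖ ≍ ‖W_i‖^γ, ‖(ξ,-1)W_i‖ ≍ ‖W_i‖⁻¹ and |det W_i| ≍ 1. -/
def IsAssociated (ξ : ℝ) (W : ℕ → M2) : Prop :=
  IsFibP W ∧ UnboundedSeq W ∧ AdmissibleFib W ∧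
  ∃ c₁ c₂ c₃ c₄ c₅ c₆ : ℝ, 0 < c₁ ∧ 0 < c₂ ∧ 0 < c₃ ∧ 0 < c₄ ∧ 0 < c₅ ∧ 0 < c₆ ∧
    ∀ i, 1 ≤ i →
      c₁ * mnorm (W i) ^ gam ≤ mnorm (W (i + 1)) ∧
      mnorm (W (i + 1)) ≤ c₂ * mnorm (W i) ^ gam ∧
      c₃ * (mnorm (W i))⁻¹ ≤ xiNorm ξ (W i) ∧
      xiNorm ξ (W i) ≤ c₄ * (mnorm (W i))⁻¹ ∧
      c₅ ≤ |((W i).det : ℝ)| ∧ |((W i).det : ℝ)| ≤ c₆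

/-- Membership in GL₂(ℤ): integer matrix of determinant ±1. -/
def InGL2Z (A : M2) : Prop := A.det = 1 ∨ A.det = -1

/-- ξ is badly approximable: irrational and |ξ - p/q| > c/q² for all rationals p/q. -/
def BadlyApprox (ξ : ℝ) : Prop :=
  Irrational ξ ∧ ∃ c : ℝ, 0 < c ∧ ∀ p q : ℤ, q ≠ 0 → c / (q : ℝ) ^ 2 < |ξ - (p : ℝ) / (q : ℝ)|

/-- Partial quotients of the continued fraction expansion: `cfA n ξ` is `aₙ`
where ξ = [a₀, a₁, a₂, …]. -/
noncomputable def cfA : ℕ → ℝ → ℤ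
  | 0, ξ => ⌊ξ⌋
  | n + 1, ξ => cfA n (ξ - ⌊ξ⌋)⁻¹

/-- A Fibonacci sequence of words (indices from 1). -/
def FibWordSeq {α : Type} (w : ℕ → List α) : Prop := ∀ i, 1 ≤ i → w (i + 2) = w (i + 1) ++ w i

/-- `b` (indexed from 1: the limit word is b₁b₂b₃…) is the infinite limit word of the
sequence of words `w`: every `w k` (k ≥ 2) is a prefix of it, and their lengths are unbounded. -/
def IsLimitWord {α : Type} (w : ℕ → List α) (b : ℕ → α) : Prop :=
  (∀ n : ℕ, ∃ k, 2 ≤ k ∧ n ≤ (w k).length) ∧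
  ∀ k, 2 ≤ k → ∀ j, (h : j < (w k).length) → (w k).get ⟨j, h⟩ = b (j + 1)

/-- The Fibonacci sequence of words over the alphabet E = {a, b} (with `b = false`,
`a = true`): w₁ = b, w₂ = a, w_{k+2} = w_{k+1} w_k.  Its limit is f_{a,b}. -/
def fw : ℕ → List Bool
  | 0 => []
  | 1 => [false]
  | 2 => [true]
  | n + 3 => fw (n + 2) ++ fw (n + 1)

/-- The prefix of length `i` of the infinite Fibonacci word `f_{a,b}`
(note `fw (i+2)` is a prefix of `f_{a,b}` of length ≥ i). -/
def fpref (i : ℕ) : List Bool := (fw (i + 2)).take i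

/-- The monoid morphism Φ : E* → (𝒫, *) with Φ(b) = W₁, Φ(a) = W₂
(the letter `b` is `false` and `a` is `true`). -/
def PhiW (W1 W2 : M2) : List Bool → M2
  | [] => 1
  | x :: u => pmul (if x then W2 else W1) (PhiW W1 W2 u)

/-- The set 𝒮₁ of real matrices (a b; c d) with a ≥ max{b,c} and min{b,c} ≥ d ≥ 0. -/
def S1 : Set (Matrix (Fin 2) (Fin 2) ℝ) :=
  {A | max (A 0 1) (A 1 0) ≤ A 0 0 ∧ A 1 1 ≤ min (A 0 1) (A 1 0) ∧ 0 ≤ A 1 1}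

/-- The set 𝒮 = 𝒮₁ ∩ GL₂(ℤ), viewed as a set of integer matrices. -/
def Sset : Set M2 :=
  {A | (A.map (Int.cast : ℤ → ℝ)) ∈ S1 ∧ (A.det = 1 ∨ A.det = -1)}

/-- ξ is an extremal real number with an associated Fibonacci sequence in GL₂(ℤ). -/
def HasGLAssoc (ξ : ℝ) : Prop :=
  IsExtremal ξ ∧ ∃ W : ℕ → M2, IsAssociated ξ W ∧ ∀ i, 1 ≤ i → InGL2Z (W i)

/-- ξ is an extremal real number with an associated Fibonacci sequence in 𝒮. -/
def HasSAssoc (ξ : ℝ) : Prop :=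
  IsExtremal ξ ∧ ∃ W : ℕ → M2, IsAssociated ξ W ∧ ∀ i, 1 ≤ i → W i ∈ Sset

/-- The determinant of three points of ℤ³. -/
def det3 (x y z : Fin 3 → ℤ) : ℤ :=
  x 0 * (y 1 * z 2 - y 2 * z 1) - x 1 * (y 0 * z 2 - y 2 * z 0) + x 2 * (y 0 * z 1 - y 1 * z 0)

/-- The determinant of the symmetric matrix attached to a point of ℤ³. -/
def symDet (x : Fin 3 → ℤ) : ℤ := x 0 * x 2 - x 1 ^ 2

/-- The distance from `x` to `x₀(1, ξ, ξ²)` in the maximum norm. -/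
noncomputable def err (ξ : ℝ) (x : Fin 3 → ℤ) : ℝ :=
  max |(x 0 : ℝ) * ξ - x 1| |(x 0 : ℝ) * ξ ^ 2 - x 2|

lemma abs_le_err_one (ξ : ℝ) (x : Fin 3 → ℤ) : |(x 0 : ℝ) * ξ - x 1| ≤ err ξ x := le_max_left _ _

lemma abs_le_err_two (ξ : ℝ) (x : Fin 3 → ℤ) : |(x 0 : ℝ) * ξ ^ 2 - x 2| ≤ err ξ x :=
  le_max_right _ _

lemma err_nonneg (ξ : ℝ) (x : Fin 3 → ℤ) : 0 ≤ err ξ x :=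
  (abs_nonneg _).trans (abs_le_err_one ξ x)

lemma err_smul (ξ : ℝ) (a : ℤ) (x : Fin 3 → ℤ) : err ξ (a • x) = |(a : ℝ)| * err ξ x := by
  unfold err
  rw [mul_max_of_nonneg _ _ (abs_nonneg _), ← abs_mul, ← abs_mul]
  simp only [Pi.smul_apply, smul_eq_mul, Int.cast_mul]
  congr 2 <;> ring

lemma err_add_le (ξ : ℝ) (x y : Fin 3 → ℤ) : err ξ (x + y) ≤ err ξ x + err ξ y := by
  refine max_le ?_ ?_
  · have h := abs_add_le ((x 0 : ℝ) * ξ - x 1) ((y 0 : ℝ) * ξ - y 1)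
    have := abs_le_err_one ξ x
    have := abs_le_err_one ξ y
    have e : (((x + y) 0 : ℤ) : ℝ) * ξ - ((x + y) 1 : ℤ)
      = ((x 0 : ℝ) * ξ - x 1) + ((y 0 : ℝ) * ξ - y 1) := by
      simp only [Pi.add_apply, Int.cast_add]; ring
    rw [e]; linarith
  · have h := abs_add_le ((x 0 : ℝ) * ξ ^ 2 - x 2) ((y 0 : ℝ) * ξ ^ 2 - y 2)
    have := abs_le_err_two ξ x
    have := abs_le_err_two ξ y
    have e : (((x + y) 0 : ℤ) : ℝ) * ξ ^ 2 - ((x + y) 2 : ℤ)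
      = ((x 0 : ℝ) * ξ ^ 2 - x 2) + ((y 0 : ℝ) * ξ ^ 2 - y 2) := by
      simp only [Pi.add_apply, Int.cast_add]; ring
    rw [e]; linarith

lemma one_le_err_of_zero {ξ : ℝ} {x : Fin 3 → ℤ} (hx : x ≠ 0) (h0 : x 0 = 0) : 1 ≤ err ξ x := by
  have h : x 1 ≠ 0 ∨ x 2 ≠ 0 := by
    by_contra! h
    apply hx
    funext i
    fin_cases i <;> simp [h0, h.1, h.2]
  rcases h with h | h
  · refine le_trans ?_ (abs_le_err_one ξ x)
    simp only [h0, Int.cast_zero, zero_mul, zero_sub, abs_neg]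
    exact_mod_cast Int.one_le_abs h
  · refine le_trans ?_ (abs_le_err_two ξ x)
    simp only [h0, Int.cast_zero, zero_mul, zero_sub, abs_neg]
    exact_mod_cast Int.one_le_abs h

lemma gam_pos : 0 < gam := by unfold gam; positivity

lemma inv_gam_sq : (1 / gam) ^ 2 = 1 - 1 / gam := by
  have h : gam ^ 2 = gam + 1 := by
    unfold gam
    have := Real.sq_sqrt (show (0 : ℝ) ≤ 5 by norm_num)
    nlinarith
  have := gam_pos.ne'
  field_simp
  linarith

lemma inv_gam_pos : 0 < 1 / gam := one_div_pos.mpr gam_pos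

lemma inv_gam_bounds : 3 / 5 < 1 / gam ∧ 1 / gam < 2 / 3 := by
  have h := inv_gam_sq
  have h0 := inv_gam_pos
  constructor <;> nlinarith

lemma gam_eq : gam = 1 + 1 / gam := by
  have h := inv_gam_sq
  have := gam_pos.ne'
  field_simp at h ⊢
  linarith

lemma IsExtremal.err_pos {ξ : ℝ} (hξ : IsExtremal ξ) {x : Fin 3 → ℤ} (hx : x ≠ 0) :
    0 < err ξ x := by
  by_cases h0 : x 0 = 0
  · linarith [one_le_err_of_zero (ξ := ξ) hx h0]
  · refine lt_of_lt_of_le ?_ (abs_le_err_one ξ x)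
    rw [abs_pos]
    intro h
    refine hξ.1 0 (x 0) (-x 1) (fun h' => h0 (by exact_mod_cast h'.2.1)) ?_
    push_cast
    linarith

/-- The defining property of an extremal number, in terms of `err`. -/
lemma IsExtremal.exists_err_le {ξ : ℝ} (hξ : IsExtremal ξ) : ∃ c : ℝ, 0 < c ∧ ∀ X : ℝ, 1 ≤ X →
    ∃ z : Fin 3 → ℤ, z ≠ 0 ∧ |(z 0 : ℝ)| ≤ X ∧ err ξ z ≤ c * X ^ (-(1 / gam)) := by
  obtain ⟨-, c, hc, h⟩ := hξ
  refine ⟨c, hc, fun X hX => ?_⟩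
  obtain ⟨a, b, d, h0, h1, h2, h3⟩ := h X hX
  rw [neg_div] at h2 h3
  refine ⟨![a, b, d], fun h => h0 ⟨?_, ?_, ?_⟩, by simpa using h1,
    max_le (by simpa using h2) (by simpa using h3)⟩
  · simpa using congrFun h 0
  · simpa using congrFun h 1
  · simpa using congrFun h 2

lemma IsExtremal.exists_err_lt {ξ : ℝ} (hξ : IsExtremal ξ) {ε : ℝ} (hε : 0 < ε) :
    ∃ z : Fin 3 → ℤ, z ≠ 0 ∧ err ξ z < ε := by
  obtain ⟨c, hc, h⟩ := hξ.exists_err_le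
  have ht : Filter.Tendsto (fun X : ℝ => c * X ^ (-(1 / gam))) Filter.atTop (nhds (c * 0)) :=
    (tendsto_rpow_neg_atTop inv_gam_pos).const_mul c
  rw [mul_zero] at ht
  obtain ⟨X, hX1, hX⟩ := ((ht.eventually (gt_mem_nhds hε)).and
    (Filter.eventually_ge_atTop 1)).exists
  obtain ⟨z, hz, -, h2⟩ := h X hX
  exact ⟨z, hz, h2.trans_lt hX1⟩

lemma finite_err_lt_one (ξ : ℝ) (n : ℤ) :
    {z : Fin 3 → ℤ | |z 0| ≤ n ∧ err ξ z < 1}.Finite := by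
  have hB : ∀ (t : ℝ) (z0 z1 : ℤ), |z0| ≤ n → |(z0 : ℝ) * t - z1| < 1 →
      |z1| ≤ ⌈n * |t| + 1⌉ := by
    intro t z0 z1 h0 h1
    have : |(z1 : ℝ)| ≤ n * |t| + 1 := by
      have h2 := abs_sub_abs_le_abs_sub (z1 : ℝ) ((z0 : ℝ) * t)
      rw [abs_sub_comm, abs_mul] at h2
      have h3 : |(z0 : ℝ)| ≤ n := by exact_mod_cast h0
      have := mul_le_mul_of_nonneg_right h3 (abs_nonneg t)
      linarith
    have h3 := this.trans (Int.le_ceil _)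
    exact_mod_cast h3
  set m := max n (max ⌈n * |ξ| + 1⌉ ⌈n * |ξ ^ 2| + 1⌉) with hm
  refine (Set.finite_Icc (fun _ => -m : Fin 3 → ℤ) (fun _ => m)).subset ?_
  rintro z ⟨h0, h1⟩
  have a1 := hB ξ _ _ h0 ((abs_le_err_one ξ z).trans_lt h1)
  have a2 := hB (ξ ^ 2) _ _ h0 ((abs_le_err_two ξ z).trans_lt h1)
  have hall : ∀ i, |z i| ≤ m := by
    intro i
    fin_cases i
    · exact h0.trans (le_max_left _ _)
    · exact a1.trans ((le_max_left _ _).trans (le_max_right _ _))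
    · exact a2.trans ((le_max_right _ _).trans (le_max_right _ _))
  exact ⟨fun i => (abs_le.mp (hall i)).1, fun i => (abs_le.mp (hall i)).2⟩

lemma IsExtremal.exists_minimal {ξ : ℝ} (hξ : IsExtremal ξ) {ε : ℝ} (hε : 0 < ε) (hε1 : ε ≤ 1) :
    ∃ y : Fin 3 → ℤ, y ≠ 0 ∧ err ξ y < ε ∧ (∀ z, z ≠ 0 → |z 0| < |y 0| → ε ≤ err ξ z) ∧
      ∀ z, z ≠ 0 → |z 0| ≤ |y 0| → err ξ y ≤ err ξ z := by
  classical
  have hex : ∃ n : ℕ, ∃ z : Fin 3 → ℤ, z ≠ 0 ∧ err ξ z < ε ∧ (z 0).natAbs = n := by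
    obtain ⟨z, h1, h2⟩ := hξ.exists_err_lt hε
    exact ⟨_, z, h1, h2, rfl⟩
  obtain ⟨n, hn⟩ : ∃ n, n = Nat.find hex := ⟨_, rfl⟩
  have hmin : ∀ z : Fin 3 → ℤ, z ≠ 0 → err ξ z < ε → n ≤ (z 0).natAbs := fun z h1 h2 =>
    hn ▸ Nat.find_le (h := hex) ⟨z, h1, h2, rfl⟩
  have hfin : {z : Fin 3 → ℤ | z ≠ 0 ∧ err ξ z < ε ∧ (z 0).natAbs = n}.Finite := by
    refine (finite_err_lt_one ξ n).subset ?_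
    rintro z ⟨-, h2, h3⟩
    exact ⟨by rw [Int.abs_eq_natAbs, h3], h2.trans_le hε1⟩
  obtain ⟨y, ⟨hy0, hy1, hy2⟩, hy3⟩ := Set.exists_min_image _ (err ξ) hfin (hn ▸ Nat.find_spec hex)
  refine ⟨y, hy0, hy1, fun z hz hlt => ?_, fun z hz hle => ?_⟩
  · rw [Int.abs_eq_natAbs, Int.abs_eq_natAbs] at hlt
    by_contra! h
    have := hmin z hz h
    omega
  · rw [Int.abs_eq_natAbs, Int.abs_eq_natAbs] at hle
    rcases lt_or_ge (err ξ z) ε with h | h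
    · have := hmin z hz h
      exact hy3 z ⟨hz, h, by omega⟩
    · linarith

/-- A sequence of minimal points for `ξ`. -/
structure IsMinSeq (ξ : ℝ) (x : ℕ → Fin 3 → ℤ) : Prop where
  ne_zero : ∀ i, x i 0 ≠ 0
  err_lt_one : ∀ i, err ξ (x i) < 1
  abs_lt : ∀ i, |x i 0| < |x (i + 1) 0|
  err_lt : ∀ i, err ξ (x (i + 1)) < err ξ (x i)
  minimal : ∀ i z, z ≠ 0 → |z 0| < |x (i + 1) 0| → err ξ (x i) ≤ err ξ z

lemma IsExtremal.exists_isMinSeq {ξ : ℝ} (hξ : IsExtremal ξ) : ∃ x, IsMinSeq ξ x := by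
  let P : Type := {y : Fin 3 → ℤ // y ≠ 0 ∧ err ξ y < 1 ∧
    ∀ z, z ≠ 0 → |z 0| ≤ |y 0| → err ξ y ≤ err ξ z}
  have hstep : ∀ p : P, ∃ q : P, err ξ q.1 < err ξ p.1 ∧
      ∀ z, z ≠ 0 → |z 0| < |q.1 0| → err ξ p.1 ≤ err ξ z := by
    rintro ⟨p, hp0, hp1, hp2⟩
    obtain ⟨y, h1, h2, h3, h4⟩ := hξ.exists_minimal (hξ.err_pos hp0) hp1.le
    exact ⟨⟨y, h1, h2.trans hp1, h4⟩, h2, h3⟩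
  obtain ⟨y, h1, h2, -, h4⟩ := hξ.exists_minimal one_pos le_rfl
  choose f hf1 hf2 using hstep
  let s : ℕ → P := fun n => f^[n] ⟨y, h1, h2, h4⟩
  have hs : ∀ n, s (n + 1) = f (s n) := fun n => Function.iterate_succ_apply' f n _
  refine ⟨fun n => (s n).1, fun i h => ?_, fun i => (s i).2.2.1, fun i => ?_, fun i => ?_,
    fun i z => ?_⟩
  · linarith [one_le_err_of_zero (ξ := ξ) (s i).2.1 h, (s i).2.2.1]
  · by_contra! h
    have := (s i).2.2.2 _ (s (i + 1)).2.1 h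
    rw [hs] at this
    linarith [hf1 (s i)]
  · rw [hs]; exact hf1 _
  · rw [hs]; exact hf2 _ z

lemma exists_two_mul_abs_sub_le (α D : ℤ) (hD : D ≠ 0) : ∃ a : ℤ, 2 * |α - a * D| ≤ |D| := by
  refine ⟨round ((α : ℝ) / D), ?_⟩
  have h := abs_sub_round ((α : ℝ) / D)
  have hD' : (D : ℝ) ≠ 0 := by exact_mod_cast hD
  have h1 : |(α : ℝ) - round ((α : ℝ) / D) * D| ≤ 1 / 2 * |(D : ℝ)| := by
    rw [show (α : ℝ) - round ((α : ℝ) / D) * D = ((α : ℝ) / D - round ((α : ℝ) / D)) * D by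
      field_simp, abs_mul]
    exact mul_le_mul_of_nonneg_right h (abs_nonneg _)
  have h2 : 2 * |(α : ℝ) - round ((α : ℝ) / D) * D| ≤ |(D : ℝ)| := by linarith
  exact_mod_cast h2

namespace IsMinSeq

variable {ξ : ℝ} {x : ℕ → Fin 3 → ℤ}

lemma shift (hx : IsMinSeq ξ x) (n : ℕ) : IsMinSeq ξ (fun i => x (i + n)) where
  ne_zero i := hx.ne_zero _
  err_lt_one i := hx.err_lt_one _
  abs_lt i := by simpa only [add_right_comm i 1 n] using hx.abs_lt (i + n)
  err_lt i := by simpa only [add_right_comm i 1 n] using hx.err_lt (i + n)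
  minimal i z := by simpa only [add_right_comm i 1 n] using hx.minimal (i + n) z

lemma strictMono_abs (hx : IsMinSeq ξ x) : StrictMono fun i => |x i 0| :=
  strictMono_nat_of_lt_succ hx.abs_lt

lemma strictAnti_err (hx : IsMinSeq ξ x) : StrictAnti fun i => err ξ (x i) :=
  strictAnti_nat_of_succ_lt hx.err_lt

lemma vec_ne_zero (hx : IsMinSeq ξ x) (i : ℕ) : x i ≠ 0 := fun h =>
  hx.ne_zero i (by rw [h]; rfl)

lemma ne_smul_of_lt (hx : IsMinSeq ξ x) {i j : ℕ} (hij : i < j) (a : ℤ) : x i ≠ a • x j := by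
  intro h
  have h1 := hx.strictMono_abs hij
  have h0 := congrFun h 0
  simp only [Pi.smul_apply, smul_eq_mul] at h0
  have ha : a ≠ 0 := by
    rintro rfl
    exact hx.ne_zero i (by simpa using h0)
  simp only [h0, abs_mul] at h1
  nlinarith [Int.one_le_abs ha, abs_nonneg (x j 0)]

lemma ne_smul_of_gt (hx : IsMinSeq ξ x) {i j : ℕ} (hij : i < j) (a : ℤ) : x j ≠ a • x i := by
  intro h
  have h1 := hx.strictAnti_err hij
  have ha : a ≠ 0 := by
    rintro rfl
    exact hx.vec_ne_zero j (by simpa using h)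
  simp only [h, err_smul] at h1
  have h2 : (1 : ℝ) ≤ |(a : ℝ)| := by exact_mod_cast Int.one_le_abs ha
  nlinarith [err_nonneg ξ (x i)]

/-- Distinct minimal points are not proportional. -/
lemma not_proportional (hx : IsMinSeq ξ x) {i j : ℕ} (hij : i < j) {a b : ℤ} (ha : a ≠ 0)
    (h : a • x i = b • x j) : False := by
  have h1 := hx.strictMono_abs hij
  have h2 := hx.strictAnti_err hij
  have h0 : |(a : ℝ)| * |(x i 0 : ℝ)| = |(b : ℝ)| * |(x j 0 : ℝ)| := by
    have := congrFun h 0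
    simp only [Pi.smul_apply, smul_eq_mul] at this
    rw [← abs_mul, ← abs_mul]
    exact_mod_cast congrArg abs this
  have h3 := congrArg (err ξ) h
  rw [err_smul, err_smul] at h3
  have h1' : |(x i 0 : ℝ)| < |(x j 0 : ℝ)| := by exact_mod_cast h1
  have ha' : 0 < |(a : ℝ)| := by positivity
  have hi : 0 ≤ |(x i 0 : ℝ)| := abs_nonneg _
  have e0 := err_nonneg ξ (x j)
  simp only at h2
  have hb : 0 < |(b : ℝ)| := by
    rcases (abs_nonneg (b : ℝ)).eq_or_lt with hb | hb
    · rw [← hb] at h3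
      nlinarith
    · exact hb
  have hba : |(b : ℝ)| ≤ |(a : ℝ)| := by
    by_contra! hlt
    nlinarith
  nlinarith

lemma minors_ne_zero (hx : IsMinSeq ξ x) (i : ℕ) :
    x i 0 * x (i + 1) 1 - x i 1 * x (i + 1) 0 ≠ 0 ∨
      x i 0 * x (i + 1) 2 - x i 2 * x (i + 1) 0 ≠ 0 := by
  by_contra! h
  refine hx.not_proportional (Nat.lt_succ_self i) (a := x (i + 1) 0) (b := x i 0) (hx.ne_zero _) ?_
  funext k
  fin_cases k
  · simp only [Fin.zero_eta, Pi.smul_apply, smul_eq_mul]; ring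
  · simp only [Fin.mk_one, Pi.smul_apply, smul_eq_mul]; linarith [h.1]
  · simp only [Fin.reduceFinMk, Pi.smul_apply, smul_eq_mul]; linarith [h.2]

/-- Consecutive minimal points form a basis of the integer points of the plane they span. -/
lemma exists_eq_add (hx : IsMinSeq ξ x) (i : ℕ) {z : Fin 3 → ℤ}
    (hz : det3 (x i) (x (i + 1)) z = 0) : ∃ a b : ℤ, z = a • x i + b • x (i + 1) := by
  obtain ⟨D, α, β, hD, hk⟩ : ∃ D α β : ℤ, D ≠ 0 ∧ ∀ k, D * z k = α * x i k + β * x (i + 1) k := by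
    unfold det3 at hz
    rcases hx.minors_ne_zero i with h | h
    · refine ⟨_, z 0 * x (i + 1) 1 - z 1 * x (i + 1) 0, x i 0 * z 1 - x i 1 * z 0, h, fun k => ?_⟩
      fin_cases k
      · simp only [Fin.zero_eta]; ring
      · simp only [Fin.mk_one]; ring
      · simp only [Fin.reduceFinMk]; linear_combination hz
    · refine ⟨_, z 0 * x (i + 1) 2 - z 2 * x (i + 1) 0, x i 0 * z 2 - x i 2 * z 0, h, fun k => ?_⟩
      fin_cases k
      · simp only [Fin.zero_eta]; ring
      · simp only [Fin.mk_one]; linear_combination -hz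
      · simp only [Fin.reduceFinMk]; ring
  obtain ⟨a, ha⟩ := exists_two_mul_abs_sub_le α D hD
  obtain ⟨b, hb⟩ := exists_two_mul_abs_sub_le β D hD
  refine ⟨a, b, ?_⟩
  set w := z - (a • x i + b • x (i + 1)) with hw
  have hDw : D • w = (α - a * D) • x i + (β - b * D) • x (i + 1) := by
    funext k
    simp only [hw, Pi.smul_apply, Pi.sub_apply, Pi.add_apply, smul_eq_mul]
    linear_combination hk k
  by_contra hne
  have hw0 : w ≠ 0 := fun h => hne (sub_eq_zero.mp h)
  have hDp : 0 < |D| := abs_pos.mpr hD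
  have h0 : |w 0| < |x (i + 1) 0| := by
    have h1 := congrFun hDw 0
    simp only [Pi.smul_apply, Pi.add_apply, smul_eq_mul] at h1
    have h2 := abs_add_le ((α - a * D) * x i 0) ((β - b * D) * x (i + 1) 0)
    rw [← h1, abs_mul, abs_mul, abs_mul] at h2
    have h3 := hx.abs_lt i
    have h4 := abs_nonneg (x i 0)
    have h5 := mul_le_mul_of_nonneg_right ha h4
    have h6 := mul_le_mul_of_nonneg_right hb (abs_nonneg (x (i + 1) 0))
    nlinarith
  have h1 := hx.minimal i w hw0 h0
  have h2 := err_add_le ξ ((α - a * D) • x i) ((β - b * D) • x (i + 1))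
  rw [← hDw, err_smul, err_smul, err_smul] at h2
  have h3 := hx.err_lt i
  have ha' : 2 * |((α - a * D : ℤ) : ℝ)| ≤ |(D : ℝ)| := by exact_mod_cast ha
  have hb' : 2 * |((β - b * D : ℤ) : ℝ)| ≤ |(D : ℝ)| := by exact_mod_cast hb
  have h5 := mul_le_mul_of_nonneg_right ha' (err_nonneg ξ (x i))
  have h6 := mul_le_mul_of_nonneg_right hb' (err_nonneg ξ (x (i + 1)))
  have hDp' : 0 < |(D : ℝ)| := by exact_mod_cast hDp
  nlinarith

/-- Along indices where three consecutive minimal points are dependent, the cross product of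
consecutive points only changes by integer factors. -/
lemma exists_cross_eq (hx : IsMinSeq ξ x) {i : ℕ} (k : ℕ)
    (h : ∀ m, i < m → m ≤ i + k → det3 (x (m - 1)) (x m) (x (m + 1)) = 0) :
    ∃ n : ℤ, n ≠ 0 ∧ ∀ r s, x i r * x (i + 1) s - x i s * x (i + 1) r =
      n * (x (i + k) r * x (i + k + 1) s - x (i + k) s * x (i + k + 1) r) := by
  induction k with
  | zero => exact ⟨1, one_ne_zero, fun r s => by simp⟩
  | succ k ih =>
    obtain ⟨n, hn, hrs⟩ := ih fun m h1 h2 => h m h1 (by omega)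
    have hd := h (i + k + 1) (by omega) (by omega)
    simp only [Nat.add_sub_cancel] at hd
    obtain ⟨a, b, hab⟩ := hx.exists_eq_add (i + k + 1) (z := x (i + k))
      (by unfold det3 at hd ⊢; linear_combination hd)
    have hb : b ≠ 0 := by
      rintro rfl
      exact hx.ne_smul_of_lt (Nat.lt_succ_self (i + k)) a (by simpa using hab)
    refine ⟨n * -b, mul_ne_zero hn (neg_ne_zero.mpr hb), fun r s => ?_⟩
    have hr := congrFun hab r
    have hs := congrFun hab s
    simp only [Pi.smul_apply, Pi.add_apply, smul_eq_mul] at hr hs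
    rw [hrs, hr, hs, show i + (k + 1) = i + k + 1 from rfl]
    ring

lemma det3_ne_zero_of_consecutive (hx : IsMinSeq ξ x) {i j l : ℕ} (hij : i < j) (hjl : j < l)
    (hi : ∀ m, i < m → m < j → det3 (x (m - 1)) (x m) (x (m + 1)) = 0)
    (hj : det3 (x (j - 1)) (x j) (x (j + 1)) ≠ 0)
    (hl : ∀ m, j < m → m < l → det3 (x (m - 1)) (x m) (x (m + 1)) = 0) :
    det3 (x i) (x j) (x l) ≠ 0 := by
  obtain ⟨k, rfl⟩ : ∃ k, j = i + k + 1 := ⟨j - i - 1, by omega⟩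
  obtain ⟨k', rfl⟩ : ∃ k', l = i + k + 1 + k' + 1 := ⟨l - (i + k + 1) - 1, by omega⟩
  obtain ⟨n, hn, hrs⟩ := hx.exists_cross_eq k fun m h1 h2 => hi m h1 (by omega)
  obtain ⟨n', hn', hrs'⟩ := hx.exists_cross_eq k' fun m h1 h2 => hl m h1 (by omega)
  simp only [Nat.add_sub_cancel] at hj
  obtain ⟨a, b, hab⟩ := hx.exists_eq_add (i + k) (z := x i) (by
    have h1 := hrs 1 2
    have h2 := hrs 0 2
    have h3 := hrs 0 1
    apply (mul_eq_zero.mp (_ : n * _ = 0)).resolve_left hn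
    unfold det3
    linear_combination (-x i 0) * h1 + x i 1 * h2 - x i 2 * h3)
  obtain ⟨a', b', hab'⟩ := hx.exists_eq_add (i + k + 1) (z := x (i + k + 1 + k' + 1)) (by
    have h1 := hrs' 1 2
    have h2 := hrs' 0 2
    have h3 := hrs' 0 1
    unfold det3
    linear_combination (x (i + k + 1 + k' + 1) 0) * h1 - x (i + k + 1 + k' + 1) 1 * h2 +
      x (i + k + 1 + k' + 1) 2 * h3)
  have ha : a ≠ 0 := by
    rintro rfl
    exact hx.ne_smul_of_lt hij b (by simpa using hab)
  have hb' : b' ≠ 0 := by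
    rintro rfl
    exact hx.ne_smul_of_gt hjl a' (by simpa using hab')
  have key : det3 (x i) (x (i + k + 1)) (x (i + k + 1 + k' + 1)) =
      a * b' * det3 (x (i + k)) (x (i + k + 1)) (x (i + k + 1 + 1)) := by
    have e := fun r => congrFun hab r
    have e' := fun r => congrFun hab' r
    simp only [Pi.smul_apply, Pi.add_apply, smul_eq_mul] at e e'
    unfold det3
    rw [e 0, e 1, e 2, e' 0, e' 1, e' 2]
    ring
  rw [key]
  exact mul_ne_zero (mul_ne_zero ha hb') hj

end IsMinSeq

lemma one_le_abs_cast {n : ℤ} (h : n ≠ 0) : (1 : ℝ) ≤ |(n : ℝ)| := by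
  exact_mod_cast Int.one_le_abs h

lemma abs_det3_le (ξ : ℝ) (x y z : Fin 3 → ℤ) : |(det3 x y z : ℝ)| ≤
    2 * (|(x 0 : ℝ)| * (err ξ y * err ξ z) + |(y 0 : ℝ)| * (err ξ x * err ξ z) +
      |(z 0 : ℝ)| * (err ξ x * err ξ y)) := by
  have key : ∀ u v w : Fin 3 → ℤ, |(u 0 : ℝ) * (((v 0 : ℝ) * ξ - v 1) * ((w 0 : ℝ) * ξ ^ 2 - w 2) -
      ((v 0 : ℝ) * ξ ^ 2 - v 2) * ((w 0 : ℝ) * ξ - w 1))| ≤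
      2 * (|(u 0 : ℝ)| * (err ξ v * err ξ w)) := by
    intro u v w
    rw [abs_mul]
    have h1 := mul_le_mul (abs_le_err_one ξ v) (abs_le_err_two ξ w) (abs_nonneg _) (err_nonneg _ _)
    have h2 := mul_le_mul (abs_le_err_two ξ v) (abs_le_err_one ξ w) (abs_nonneg _) (err_nonneg _ _)
    rw [← abs_mul] at h1 h2
    have h3 := abs_sub (((v 0 : ℝ) * ξ - v 1) * ((w 0 : ℝ) * ξ ^ 2 - w 2))
      (((v 0 : ℝ) * ξ ^ 2 - v 2) * ((w 0 : ℝ) * ξ - w 1))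
    nlinarith [abs_nonneg (u 0 : ℝ)]
  have e : (det3 x y z : ℝ) =
      (x 0 : ℝ) * (((y 0 : ℝ) * ξ - y 1) * ((z 0 : ℝ) * ξ ^ 2 - z 2) -
      ((y 0 : ℝ) * ξ ^ 2 - y 2) * ((z 0 : ℝ) * ξ - z 1)) -
      (y 0 : ℝ) * (((x 0 : ℝ) * ξ - x 1) * ((z 0 : ℝ) * ξ ^ 2 - z 2) -
      ((x 0 : ℝ) * ξ ^ 2 - x 2) * ((z 0 : ℝ) * ξ - z 1)) +
      (z 0 : ℝ) * (((x 0 : ℝ) * ξ - x 1) * ((y 0 : ℝ) * ξ ^ 2 - y 2) -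
      ((x 0 : ℝ) * ξ ^ 2 - x 2) * ((y 0 : ℝ) * ξ - y 1)) := by
    unfold det3; push_cast; ring
  rw [e]
  refine (abs_add_le _ _).trans ?_
  refine (add_le_add_left (abs_sub _ _) _).trans ?_
  linarith [key x y z, key y x z, key z x y]

lemma abs_symDet_le {ξ : ℝ} {x : Fin 3 → ℤ} (h0 : x 0 ≠ 0) (h1 : err ξ x ≤ 1) :
    |(symDet x : ℝ)| ≤ (2 + 2 * |ξ|) * (|(x 0 : ℝ)| * err ξ x) := by
  have e : (symDet x : ℝ) = -((x 0 : ℝ) * ((x 0 : ℝ) * ξ ^ 2 - x 2)) +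
      2 * ξ * ((x 0 : ℝ) * ((x 0 : ℝ) * ξ - x 1)) - ((x 0 : ℝ) * ξ - x 1) ^ 2 := by
    unfold symDet; push_cast; ring
  have a1 := abs_le_err_one ξ x
  have a2 := abs_le_err_two ξ x
  have a0 := err_nonneg ξ x
  have hX := one_le_abs_cast h0
  rw [e]
  refine (abs_sub _ _).trans ?_
  refine (add_le_add_left (abs_add_le _ _) _).trans ?_
  simp only [abs_neg, abs_mul, abs_pow, abs_two]
  have b1 := mul_le_mul_of_nonneg_left a2 (abs_nonneg (x 0 : ℝ))
  have b2 := mul_le_mul_of_nonneg_left a1 (abs_nonneg (x 0 : ℝ))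
  have b3 := mul_le_mul_of_nonneg_left b2 (abs_nonneg ξ)
  have b4 := mul_le_mul a1 a1 (abs_nonneg _) a0
  nlinarith

/-- A point with `symDet x = 0` is a multiple of `(m², mn, n²)`. -/
lemma exists_of_symDet_eq_zero {x : Fin 3 → ℤ} (h0 : x 0 ≠ 0) (h : symDet x = 0) :
    ∃ d m n : ℤ, d ≠ 0 ∧ m ≠ 0 ∧ x 0 = d * m ^ 2 ∧ x 1 = d * m * n ∧ x 2 = d * n ^ 2 := by
  obtain ⟨g, m, n, hg, hcop, hm, hn⟩ : ∃ g m n : ℤ, g ≠ 0 ∧ IsCoprime m n ∧ x 0 = m * g ∧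
      x 1 = n * g := by
    have hpos : 0 < Int.gcd (x 0) (x 1) := Int.gcd_pos_of_ne_zero_left _ h0
    obtain ⟨m, n, h1, h2, h3⟩ := Int.exists_gcd_one hpos
    exact ⟨_, m, n, by exact_mod_cast hpos.ne', Int.isCoprime_iff_gcd_eq_one.mpr h1, h2, h3⟩
  have hm0 : m ≠ 0 := by
    rintro rfl
    simp [hm] at h0
  unfold symDet at h
  rw [hm, hn] at h
  have h' : m * x 2 = n ^ 2 * g := mul_left_cancel₀ hg (by linear_combination h)
  obtain ⟨d, rfl⟩ : m ∣ g := (hcop.pow_right (n := 2)).dvd_of_dvd_mul_left ⟨x 2, h'.symm⟩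
  have hd : d ≠ 0 := right_ne_zero_of_mul hg
  refine ⟨d, m, n, hd, hm0, by rw [hm]; ring, by rw [hn]; ring, ?_⟩
  exact mul_left_cancel₀ hm0 (by linear_combination h')

/-- If `symDet x = 0`, then every point which is both smaller and closer to `(1, ξ, ξ²)` than a
suitable bound is proportional to `x`. -/
lemma proportional_of_symDet_eq_zero {ξ : ℝ} {x z : Fin 3 → ℤ} (h0 : x 0 ≠ 0) (h : symDet x = 0)
    (hz : |z 0| ≤ |x 0|) (hx1 : err ξ x ≤ err ξ z) (hz1 : err ξ z ≤ 1)
    (hb : |(x 0 : ℝ)| * ((3 + 3 * |ξ|) * err ξ z) ^ 2 < 1) : z 0 • x = x 0 • z := by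
  obtain ⟨d, m, n, hd, hm, e0, e1, e2⟩ := exists_of_symDet_eq_zero h0 h
  set E := err ξ z with hE
  have hE0 : 0 ≤ E := err_nonneg ξ z
  have hd1 := one_le_abs_cast hd
  have hm1 := one_le_abs_cast hm
  have hzr : |(z 0 : ℝ)| ≤ |(x 0 : ℝ)| := by exact_mod_cast hz
  have hx0 : |(x 0 : ℝ)| = |(d : ℝ)| * |(m : ℝ)| ^ 2 := by
    rw [e0]; push_cast; rw [abs_mul, abs_pow]
  have hsmall : |(m : ℝ)| * ((3 + 3 * |ξ|) * E) < 1 := by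
    have h1 : (|(m : ℝ)| * ((3 + 3 * |ξ|) * E)) ^ 2 < 1 := by
      rw [mul_pow]
      refine lt_of_le_of_lt ?_ hb
      rw [hx0]
      refine mul_le_mul_of_nonneg_right ?_ (sq_nonneg _)
      nlinarith [sq_nonneg |(m : ℝ)|]
    exact (pow_lt_one_iff_of_nonneg (by positivity) two_ne_zero).mp h1
  have hmn : |(z 0 : ℝ)| * |(m : ℝ) * ξ - n| ≤ |(m : ℝ)| * E := by
    have h1 : |(d : ℝ)| * |(m : ℝ)| * |(m : ℝ) * ξ - n| ≤ E := by
      refine le_trans (le_of_eq ?_) ((abs_le_err_one ξ x).trans hx1)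
      rw [← abs_mul, ← abs_mul, e0, e1]
      push_cast
      congr 1
      ring
    calc |(z 0 : ℝ)| * |(m : ℝ) * ξ - n| ≤ |(x 0 : ℝ)| * |(m : ℝ) * ξ - n| := by gcongr
      _ = |(m : ℝ)| * (|(d : ℝ)| * |(m : ℝ)| * |(m : ℝ) * ξ - n|) := by rw [hx0]; ring
      _ ≤ _ := by gcongr
  have hδ : |(m : ℝ) * ξ - n| ≤ |(m : ℝ)| * E := by
    have h1 : |(d : ℝ)| * |(m : ℝ)| * |(m : ℝ) * ξ - n| ≤ E := by
      refine le_trans (le_of_eq ?_) ((abs_le_err_one ξ x).trans hx1)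
      rw [← abs_mul, ← abs_mul, e0, e1]
      push_cast
      congr 1
      ring
    have h2 : 1 ≤ |(d : ℝ)| * |(m : ℝ)| := one_le_mul_of_one_le_of_one_le hd1 hm1
    nlinarith [abs_nonneg ((m : ℝ) * ξ - n)]
  have z1 := abs_le_err_one ξ z
  have z2 := abs_le_err_two ξ z
  rw [← hE] at z1 z2
  have hmE : 0 ≤ |(m : ℝ)| * E := by positivity
  have k1 : z 0 * n = z 1 * m := by
    have h1 : |((z 0 * n - z 1 * m : ℤ) : ℝ)| < 1 := by
      have e : ((z 0 * n - z 1 * m : ℤ) : ℝ) =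
          m * ((z 0 : ℝ) * ξ - z 1) - z 0 * ((m : ℝ) * ξ - n) := by push_cast; ring
      rw [e]
      refine (abs_sub _ _).trans_lt ?_
      rw [abs_mul, abs_mul]
      have := mul_le_mul_of_nonneg_left z1 (abs_nonneg (m : ℝ))
      nlinarith [abs_nonneg ξ]
    have h2 : |z 0 * n - z 1 * m| < 1 := by exact_mod_cast h1
    linarith [Int.abs_lt_one_iff.mp h2]
  have k2 : z 1 * n = z 2 * m := by
    have h1 : |((z 1 * n - z 2 * m : ℤ) : ℝ)| < 1 := by
      have e : ((z 1 * n - z 2 * m : ℤ) : ℝ) = m * ((z 0 : ℝ) * ξ ^ 2 - z 2)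
          - ξ * (m * ((z 0 : ℝ) * ξ - z 1)) - ξ * (z 0 * ((m : ℝ) * ξ - n))
          + ((z 0 : ℝ) * ξ - z 1) * ((m : ℝ) * ξ - n) := by push_cast; ring
      rw [e]
      refine (abs_add_le _ _).trans_lt ?_
      refine (add_le_add_left (abs_sub _ _) _).trans_lt ?_
      refine (add_le_add_left (add_le_add_left (abs_sub _ _) _) _).trans_lt ?_
      simp only [abs_mul]
      have b1 := mul_le_mul_of_nonneg_left z1 (abs_nonneg (m : ℝ))
      have b2 := mul_le_mul_of_nonneg_left z2 (abs_nonneg (m : ℝ))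
      have b3 := mul_le_mul_of_nonneg_left b1 (abs_nonneg ξ)
      have b4 := mul_le_mul_of_nonneg_left hmn (abs_nonneg ξ)
      have b5 := mul_le_mul (z1.trans hz1) hδ (abs_nonneg _) zero_le_one
      nlinarith [abs_nonneg ξ, mul_nonneg (abs_nonneg ξ) hmE]
    have h2 : |z 1 * n - z 2 * m| < 1 := by exact_mod_cast h1
    linarith [Int.abs_lt_one_iff.mp h2]
  funext k
  fin_cases k
  · simp only [Fin.zero_eta, Pi.smul_apply, smul_eq_mul]; ring
  · simp only [Fin.mk_one, Pi.smul_apply, smul_eq_mul, e0, e1]; linear_combination d * m * k1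
  · simp only [Fin.reduceFinMk, Pi.smul_apply, smul_eq_mul, e0, e2]
    linear_combination d * n * k1 + d * m * k2

namespace IsMinSeq

variable {ξ : ℝ} {x : ℕ → Fin 3 → ℤ}

lemma natCast_lt_abs (hx : IsMinSeq ξ x) (i : ℕ) : (i : ℝ) < |(x i 0 : ℝ)| := by
  have h : ∀ i : ℕ, (i : ℤ) < |x i 0| := by
    intro i
    induction i with
    | zero => simpa using hx.ne_zero 0
    | succ i ih => have := hx.abs_lt i; push_cast; omega
  exact_mod_cast h i

lemma tendsto_log_abs (hx : IsMinSeq ξ x) :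
    Filter.Tendsto (fun i => Real.log |(x i 0 : ℝ)|) Filter.atTop Filter.atTop :=
  Real.tendsto_log_atTop.comp
    (Filter.tendsto_atTop_mono (fun i => (hx.natCast_lt_abs i).le) tendsto_natCast_atTop_atTop)

lemma log_err_le (hx : IsMinSeq ξ x) (hξ : IsExtremal ξ) : ∃ C : ℝ, ∀ i,
    Real.log (err ξ (x i)) ≤ C - 1 / gam * Real.log |(x (i + 1) 0 : ℝ)| := by
  obtain ⟨c, hc, h⟩ := hξ.exists_err_le
  refine ⟨Real.log c + 1 / gam * Real.log 2, fun i => ?_⟩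
  have h2 : 2 ≤ |(x (i + 1) 0 : ℝ)| := by
    have h1 := Int.one_le_abs (hx.ne_zero i)
    have h3 := hx.abs_lt i
    have : 2 ≤ |x (i + 1) 0| := by omega
    exact_mod_cast this
  obtain ⟨z, hz, hz0, hz1⟩ := h (|(x (i + 1) 0 : ℝ)| / 2) (by linarith)
  have hlt : |z 0| < |x (i + 1) 0| := by
    have : |(z 0 : ℝ)| < |(x (i + 1) 0 : ℝ)| := by linarith
    exact_mod_cast this
  have h4 := (hx.minimal i z hz hlt).trans hz1
  have h5 := Real.log_le_log (hξ.err_pos (hx.vec_ne_zero i)) h4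
  rw [Real.log_mul hc.ne' (by positivity), Real.log_rpow (by linarith),
    Real.log_div (by linarith) two_ne_zero] at h5
  linarith

lemma eventually_symDet_ne_zero (hx : IsMinSeq ξ x) (hξ : IsExtremal ξ) :
    ∃ i₀, ∀ i, i₀ ≤ i → symDet (x i) ≠ 0 := by
  obtain ⟨C, hC⟩ := hx.log_err_le hξ
  set K := Real.log (3 + 3 * |ξ|) with hK
  have hKpos : 0 < 3 + 3 * |ξ| := by positivity
  obtain ⟨i₀, h⟩ := Filter.eventually_atTop.mp
    (hx.tendsto_log_abs.eventually_gt_atTop (5 * |2 * K + 2 * C|))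
  refine ⟨i₀ + 1, fun i hi hdet => ?_⟩
  obtain ⟨k, rfl⟩ : ∃ k, i = k + 1 := ⟨i - 1, by omega⟩
  have h1 := h (k + 1) (by omega)
  have hep := hξ.err_pos (hx.vec_ne_zero k)
  have hX : 0 < |(x (k + 1) 0 : ℝ)| := by linarith [one_le_abs_cast (hx.ne_zero (k + 1))]
  refine hx.not_proportional (Nat.lt_succ_self k) (hx.ne_zero (k + 1)) (b := x k 0)
    (proportional_of_symDet_eq_zero (hx.ne_zero _) hdet (hx.abs_lt k).le (hx.err_lt k).le
    (hx.err_lt_one k).le ?_).symm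
  rw [← Real.log_neg_iff (by positivity), Real.log_mul hX.ne' (by positivity), Real.log_pow,
    Real.log_mul hKpos.ne' hep.ne', ← hK]
  have h2 := hC k
  have h3 := inv_gam_bounds.1
  have h4 := le_abs_self (2 * K + 2 * C)
  have h5 := abs_nonneg (2 * K + 2 * C)
  push_cast
  nlinarith

lemma exists_det3_ne_zero (hx : IsMinSeq ξ x) (hξ : IsExtremal ξ) (i : ℕ) :
    ∃ m, i < m ∧ det3 (x (m - 1)) (x m) (x (m + 1)) ≠ 0 := by
  by_contra! h
  set a := x i 1 * x (i + 1) 2 - x i 2 * x (i + 1) 1 with ha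
  set b := -(x i 0 * x (i + 1) 2 - x i 2 * x (i + 1) 0) with hb
  set c := x i 0 * x (i + 1) 1 - x i 1 * x (i + 1) 0 with hc
  have hlin : ∀ k, a * x (i + k) 0 + b * x (i + k) 1 + c * x (i + k) 2 = 0 := by
    intro k
    obtain ⟨n, -, hrs⟩ := hx.exists_cross_eq k fun m h1 _ => h m h1
    rw [ha, hb, hc, hrs 1 2, hrs 0 2, hrs 0 1]
    ring
  have hne : ¬((c : ℚ) = 0 ∧ (b : ℚ) = 0 ∧ (a : ℚ) = 0) := by
    rintro ⟨h1, h2, -⟩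
    rcases hx.minors_ne_zero i with h3 | h3
    · exact h3 (by exact_mod_cast h1)
    · exact h3 (by have : b = 0 := by exact_mod_cast h2
                   linarith)
  have hP := hξ.1 c b a hne
  push_cast at hP
  have hpos : 0 < |(c : ℝ) * ξ ^ 2 + b * ξ + a| := abs_pos.mpr hP
  obtain ⟨k, hk⟩ := exists_nat_gt ((|(b : ℝ)| + |(c : ℝ)|) / |(c : ℝ) * ξ ^ 2 + b * ξ + a|)
  rw [div_lt_iff₀ hpos] at hk
  have e : (x (i + k) 0 : ℝ) * ((c : ℝ) * ξ ^ 2 + b * ξ + a) =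
      b * ((x (i + k) 0 : ℝ) * ξ - x (i + k) 1) +
        c * ((x (i + k) 0 : ℝ) * ξ ^ 2 - x (i + k) 2) := by
    have : (a : ℝ) * x (i + k) 0 + b * x (i + k) 1 + c * x (i + k) 2 = 0 := by
      exact_mod_cast hlin k
    linear_combination this
  have h1 := congrArg abs e
  rw [abs_mul] at h1
  have h2 := abs_add_le (b * ((x (i + k) 0 : ℝ) * ξ - x (i + k) 1))
    (c * ((x (i + k) 0 : ℝ) * ξ ^ 2 - x (i + k) 2))
  rw [abs_mul, abs_mul] at h2
  have h3 := (hx.err_lt_one (i + k)).le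
  have h4 := mul_le_mul_of_nonneg_left ((abs_le_err_one ξ (x (i + k))).trans h3)
    (abs_nonneg (b : ℝ))
  have h5 := mul_le_mul_of_nonneg_left ((abs_le_err_two ξ (x (i + k))).trans h3)
    (abs_nonneg (c : ℝ))
  have h6 := hx.natCast_lt_abs (i + k)
  push_cast at h6
  have : (0 : ℝ) ≤ i := Nat.cast_nonneg i
  have h7 : (k : ℝ) * |(c : ℝ) * ξ ^ 2 + b * ξ + a| ≤
      |(x (i + k) 0 : ℝ)| * |(c : ℝ) * ξ ^ 2 + b * ξ + a| :=
    mul_le_mul_of_nonneg_right (by linarith) hpos.le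
  linarith

end IsMinSeq

/-- The properties of the points attached to an extremal number from which the associated
Fibonacci sequences are built. -/
structure IsFibPoints (ξ C : ℝ) (y : ℕ → Fin 3 → ℤ) : Prop where
  ne_zero : ∀ k, y k 0 ≠ 0
  err_pos : ∀ k, 0 < err ξ (y k)
  err_le_one : ∀ k, err ξ (y k) ≤ 1
  symDet_ne_zero : ∀ k, symDet (y k) ≠ 0
  det3_ne_zero : ∀ k, det3 (y k) (y (k + 1)) (y (k + 2)) ≠ 0
  log_succ_le : ∀ k, Real.log |(y (k + 1) 0 : ℝ)| ≤ gam * Real.log |(y k 0 : ℝ)| + C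
  le_log_succ : ∀ k, gam * Real.log |(y k 0 : ℝ)| ≤ Real.log |(y (k + 1) 0 : ℝ)| + C
  log_err_le : ∀ k, Real.log (err ξ (y k)) ≤ C - Real.log |(y k 0 : ℝ)|
  not_proportional : ∀ k {a b : ℤ}, a ≠ 0 → a • y k = b • y (k + 3) → False
  tendsto : Filter.Tendsto (fun k => Real.log |(y k 0 : ℝ)|) Filter.atTop Filter.atTop

lemma IsFibPoints.shift {ξ C : ℝ} {y : ℕ → Fin 3 → ℤ} (hy : IsFibPoints ξ C y) (n : ℕ) :
    IsFibPoints ξ C (fun k => y (k + n)) where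
  ne_zero k := hy.ne_zero _
  err_pos k := hy.err_pos _
  err_le_one k := hy.err_le_one _
  symDet_ne_zero k := hy.symDet_ne_zero _
  det3_ne_zero k := by simpa only [add_right_comm k _ n] using hy.det3_ne_zero (k + n)
  log_succ_le k := by simpa only [add_right_comm k 1 n] using hy.log_succ_le (k + n)
  le_log_succ k := by simpa only [add_right_comm k 1 n] using hy.le_log_succ (k + n)
  log_err_le k := hy.log_err_le _
  not_proportional k a b := by
    simpa only [add_right_comm k 3 n] using hy.not_proportional (k + n) (a := a) (b := b)
  tendsto := hy.tendsto.comp (Filter.tendsto_add_atTop_nat n)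

namespace IsMinSeq

variable {ξ : ℝ} {x : ℕ → Fin 3 → ℤ}

lemma log_det3_bound (hx : IsMinSeq ξ x) (hξ : IsExtremal ξ) {m : ℕ}
    (h : det3 (x m) (x (m + 1)) (x (m + 2)) ≠ 0) :
    0 ≤ Real.log 6 + Real.log |(x (m + 2) 0 : ℝ)| + Real.log (err ξ (x m)) +
      Real.log (err ξ (x (m + 1))) := by
  have e0 := hξ.err_pos (hx.vec_ne_zero m)
  have e1 := hξ.err_pos (hx.vec_ne_zero (m + 1))
  have e2 := hξ.err_pos (hx.vec_ne_zero (m + 2))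
  have l0 := (hx.err_lt m).le
  have l1 := (hx.err_lt (m + 1)).le
  have X0 : |(x m 0 : ℝ)| ≤ |(x (m + 1) 0 : ℝ)| := by exact_mod_cast (hx.abs_lt m).le
  have X1 : |(x (m + 1) 0 : ℝ)| ≤ |(x (m + 2) 0 : ℝ)| := by exact_mod_cast (hx.abs_lt (m + 1)).le
  have X2 : 0 < |(x (m + 2) 0 : ℝ)| := by linarith [one_le_abs_cast (hx.ne_zero (m + 2))]
  have h1 := (one_le_abs_cast h).trans (abs_det3_le ξ _ _ _)
  have h2 : |(x m 0 : ℝ)| * (err ξ (x (m + 1)) * err ξ (x (m + 2))) ≤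
      |(x (m + 2) 0 : ℝ)| * (err ξ (x m) * err ξ (x (m + 1))) := by
    rw [mul_comm (err ξ (x (m + 1)))]
    exact mul_le_mul (X0.trans X1)
      (mul_le_mul_of_nonneg_right (l1.trans l0) e1.le) (by positivity) X2.le
  have h3 : |(x (m + 1) 0 : ℝ)| * (err ξ (x m) * err ξ (x (m + 2))) ≤
      |(x (m + 2) 0 : ℝ)| * (err ξ (x m) * err ξ (x (m + 1))) := by gcongr
  have h4 : 1 ≤ 6 * |(x (m + 2) 0 : ℝ)| * err ξ (x m) * err ξ (x (m + 1)) := by linarith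
  have h5 := Real.log_nonneg h4
  rwa [Real.log_mul (by positivity) e1.ne', Real.log_mul (by positivity) e0.ne',
    Real.log_mul (by norm_num) X2.ne'] at h5

lemma log_symDet_bound (hx : IsMinSeq ξ x) (hξ : IsExtremal ξ) {m : ℕ} (h : symDet (x m) ≠ 0) :
    0 ≤ Real.log (2 + 2 * |ξ|) + Real.log |(x m 0 : ℝ)| + Real.log (err ξ (x m)) := by
  have e0 := hξ.err_pos (hx.vec_ne_zero m)
  have X0 : 0 < |(x m 0 : ℝ)| := by linarith [one_le_abs_cast (hx.ne_zero m)]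
  have h1 := Real.log_nonneg
    ((one_le_abs_cast h).trans (abs_symDet_le (hx.ne_zero m) (hx.err_lt_one m).le))
  rw [Real.log_mul (by positivity) (by positivity), Real.log_mul X0.ne' e0.ne'] at h1
  linarith

lemma abs_mul_err_le_of_cross (hx : IsMinSeq ξ x) {i j : ℕ} {n : ℤ} (hn : n ≠ 0)
    (h : ∀ r s, x i r * x (i + 1) s - x i s * x (i + 1) r =
      n * (x j r * x (j + 1) s - x j s * x (j + 1) r)) :
    |(x (j + 1) 0 : ℝ)| * err ξ (x j) ≤
      2 * (|(x (i + 1) 0 : ℝ)| * err ξ (x i)) + |(x j 0 : ℝ)| * err ξ (x (j + 1)) := by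
  have key : ∀ (t : ℝ) (s : Fin 3), (∀ k, |(x k 0 : ℝ) * t - x k s| ≤ err ξ (x k)) →
      |(x (j + 1) 0 : ℝ)| * |(x j 0 : ℝ) * t - x j s| ≤
      2 * (|(x (i + 1) 0 : ℝ)| * err ξ (x i)) + |(x j 0 : ℝ)| * err ξ (x (j + 1)) := by
    intro t s ht
    have hr : |((x j 0 * x (j + 1) s - x j s * x (j + 1) 0 : ℤ) : ℝ)| ≤
        |((x i 0 * x (i + 1) s - x i s * x (i + 1) 0 : ℤ) : ℝ)| := by
      rw [h 0 s, Int.cast_mul n, abs_mul]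
      exact le_mul_of_one_le_left (abs_nonneg _) (one_le_abs_cast hn)
    have e1 : (x (j + 1) 0 : ℝ) * ((x j 0 : ℝ) * t - x j s) =
        ((x j 0 * x (j + 1) s - x j s * x (j + 1) 0 : ℤ) : ℝ) +
          x j 0 * ((x (j + 1) 0 : ℝ) * t - x (j + 1) s) := by push_cast; ring
    have e2 : ((x i 0 * x (i + 1) s - x i s * x (i + 1) 0 : ℤ) : ℝ) =
        x (i + 1) 0 * ((x i 0 : ℝ) * t - x i s) -
          x i 0 * ((x (i + 1) 0 : ℝ) * t - x (i + 1) s) := by push_cast; ring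
    rw [← abs_mul, e1]
    refine (abs_add_le _ _).trans (add_le_add (hr.trans ?_) ?_)
    · rw [e2]
      refine (abs_sub _ _).trans ?_
      rw [abs_mul, abs_mul, two_mul]
      have X0 : |(x i 0 : ℝ)| ≤ |(x (i + 1) 0 : ℝ)| := by exact_mod_cast (hx.abs_lt i).le
      gcongr
      · exact ht i
      · exact (ht (i + 1)).trans (hx.err_lt i).le
    · rw [abs_mul]
      gcongr
      exact ht (j + 1)
  have h1 := key ξ 1 fun k => abs_le_err_one ξ _
  have h2 := key (ξ ^ 2) 2 fun k => abs_le_err_two ξ _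
  rw [show err ξ (x j) = max |(x j 0 : ℝ) * ξ - x j 1| |(x j 0 : ℝ) * ξ ^ 2 - x j 2| from rfl,
    mul_max_of_nonneg _ _ (abs_nonneg _)]
  exact max_le h1 h2

end IsMinSeq

lemma IsExtremal.exists_isFibPoints {ξ : ℝ} (hξ : IsExtremal ξ) : ∃ C y, IsFibPoints ξ C y := by
  obtain ⟨x, hx, hdet⟩ : ∃ x, IsMinSeq ξ x ∧ ∀ i, symDet (x i) ≠ 0 := by
    obtain ⟨x, hx⟩ := hξ.exists_isMinSeq
    obtain ⟨n, hn⟩ := hx.eventually_symDet_ne_zero hξ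
    exact ⟨_, hx.shift n, fun i => hn _ (Nat.le_add_left n i)⟩
  obtain ⟨C, hA⟩ := hx.log_err_le hξ
  set g := 1 / gam with hg
  have hg0 : 0 < g := inv_gam_pos
  have hgsq : g ^ 2 = 1 - g := inv_gam_sq
  have hgam : gam = 1 + g := gam_eq
  set l : ℕ → ℝ := fun i => Real.log |(x i 0 : ℝ)| with hl
  set e : ℕ → ℝ := fun i => Real.log (err ξ (x i)) with he
  set D := Real.log (2 + 2 * |ξ|) with hD
  have hB : ∀ i, 0 ≤ D + l i + e i := fun i => hx.log_symDet_bound hξ (hdet i)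
  replace hA : ∀ i, e i ≤ C - g * l (i + 1) := hA
  have hXpos : ∀ i, 0 < |(x i 0 : ℝ)| := fun i => by linarith [one_le_abs_cast (hx.ne_zero i)]
  have hepos : ∀ i, 0 < err ξ (x i) := fun i => hξ.err_pos (hx.vec_ne_zero i)
  have hlmono : Monotone l := fun i j hij => Real.log_le_log (hXpos i)
    (by exact_mod_cast hx.strictMono_abs.monotone hij)
  set p : ℕ → Prop := fun m => 0 < m ∧ det3 (x (m - 1)) (x m) (x (m + 1)) ≠ 0 with hp
  have hinf : (Set.ofPred p).Infinite := by
    rw [Set.infinite_iff_exists_gt]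
    intro a
    obtain ⟨m, h1, h2⟩ := hx.exists_det3_ne_zero hξ a
    exact ⟨m, ⟨by omega, h2⟩, h1⟩
  set K := (1 + g) * (Real.log 6 + 2 * C) with hK
  have h6 : ∀ m, p (m + 1) → 0 ≤ Real.log 6 + l (m + 2) + e m + e (m + 1) := fun m hm =>
    hx.log_det3_bound hξ hm.2
  have P1 : ∀ m, p m → l m ≤ g * l (m + 1) + K := by
    intro m hm
    obtain ⟨n, rfl⟩ : ∃ n, m = n + 1 := ⟨m - 1, by have := hm.1; omega⟩
    have h1 := h6 n hm
    have h2 : g * l (n + 1) ≤ g ^ 2 * l (n + 2) + (Real.log 6 + 2 * C) := by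
      rw [hgsq]; linarith [hA n, hA (n + 1)]
    have h3 := mul_le_mul_of_nonneg_left h2 (by linarith : 0 ≤ 1 + g)
    have h4 : (1 + g) * (g * l (n + 1)) = l (n + 1) := by linear_combination l (n + 1) * hgsq
    have h5 : (1 + g) * (g ^ 2 * l (n + 2) + (Real.log 6 + 2 * C)) = g * l (n + 2) + K := by
      rw [hK]; linear_combination g * l (n + 2) * hgsq
    linarith
  have P2 : ∀ m, p m → e m ≤ C + K - l m := fun m hm => by linarith [P1 m hm, hA m]
  have P3 : ∀ m, g * l (m + 1) ≤ C + D + l m := fun m => by linarith [hA m, hB m]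
  have P3' : ∀ m, l (m + 1) + e m ≤ C + g * (C + D + l m) := by
    intro m
    have h1 := mul_le_mul_of_nonneg_left (P3 m) hg0.le
    have h2 : l (m + 1) - g * l (m + 1) = g * (g * l (m + 1)) := by
      linear_combination -l (m + 1) * hgsq
    linarith [hA m]
  have P4 : ∀ n, p (n + 1) → - Real.log 6 - C - g * (C + D + l (n + 1)) ≤ e n := by
    intro n hn
    linarith [P3' (n + 1), h6 n hn]
  set E := Real.log (2 + Real.exp (C + K + D)) with hE
  have P5 : ∀ i j, i < j → p j → (∀ m, i < m → m < j → ¬ p m) →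
      l j ≤ (1 + g) * l i +
        (1 + g) ^ 2 * (E + C + g * (C + D) + (Real.log 6 + C + g * (C + D))) := by
    intro i j hij hj hbetween
    obtain ⟨k, rfl⟩ : ∃ k, j = i + k + 1 := ⟨j - i - 1, by omega⟩
    obtain ⟨n, hn, hrs⟩ := hx.exists_cross_eq k fun m h1 h2 => by
      by_contra h
      exact hbetween m h1 (by omega) ⟨by omega, h⟩
    have h1 := hx.abs_mul_err_le_of_cross hn hrs
    have h2 : |(x (i + k) 0 : ℝ)| * err ξ (x (i + k + 1)) ≤ Real.exp (C + K) := by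
      have h3 : |(x (i + k) 0 : ℝ)| ≤ |(x (i + k + 1) 0 : ℝ)| := by
        exact_mod_cast (hx.abs_lt _).le
      refine (mul_le_mul_of_nonneg_right h3 (hepos _).le).trans ?_
      rw [← Real.log_le_iff_le_exp (mul_pos (hXpos _) (hepos _)),
        Real.log_mul (hXpos _).ne' (hepos _).ne']
      have := P2 _ hj
      simp only [hl, he] at this
      linarith
    have h3 : 1 ≤ Real.exp D * (|(x (i + 1) 0 : ℝ)| * err ξ (x i)) := by
      rw [← Real.log_nonneg_iff (mul_pos (Real.exp_pos _) (mul_pos (hXpos _) (hepos _))),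
        Real.log_mul (Real.exp_pos _).ne' (mul_pos (hXpos _) (hepos _)).ne', Real.log_exp,
        Real.log_mul (hXpos _).ne' (hepos _).ne']
      have h4 := hB i
      have h5 := hlmono (Nat.le_succ i)
      simp only [hl, he] at h4 h5
      linarith
    have h4 : |(x (i + k + 1) 0 : ℝ)| * err ξ (x (i + k)) ≤
        (2 + Real.exp (C + K + D)) * (|(x (i + 1) 0 : ℝ)| * err ξ (x i)) := by
      rw [Real.exp_add (C + K)]
      nlinarith [Real.exp_pos (C + K)]
    have h5 := Real.log_le_log (mul_pos (hXpos _) (hepos _)) h4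
    rw [Real.log_mul (by positivity) (mul_pos (hXpos _) (hepos _)).ne',
      Real.log_mul (hXpos _).ne' (hepos _).ne', Real.log_mul (hXpos _).ne' (hepos _).ne'] at h5
    have h6 : l (i + k + 1) + e (i + k) ≤ E + (l (i + 1) + e i) := h5
    have h7 := P3' i
    have h8 := P4 _ hj
    have h9 : g ^ 2 * l (i + k + 1) ≤
        g * l i + (E + C + g * (C + D) + (Real.log 6 + C + g * (C + D))) := by
      rw [hgsq]; linarith
    have h10 := mul_le_mul_of_nonneg_left h9 (sq_nonneg (1 + g))
    have h11 : (1 + g) ^ 2 * (g ^ 2 * l (i + k + 1)) = l (i + k + 1) := by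
      linear_combination (g ^ 2 + g + 1) * l (i + k + 1) * hgsq
    have h12 : (1 + g) ^ 2 * (g * l i) = (1 + g) * l i := by
      linear_combination (1 + g) * l i * hgsq
    linarith
  have P6 : ∀ i j, i < j → p i → (1 + g) * l i ≤ l j + (1 + g) * K := by
    intro i j hij hi
    have h1 := mul_le_mul_of_nonneg_left (P1 i hi) (by linarith : 0 ≤ 1 + g)
    have h2 : (1 + g) * (g * l (i + 1)) = l (i + 1) := by linear_combination l (i + 1) * hgsq
    have h3 : l (i + 1) ≤ l j := hlmono hij
    linarith
  have hmem : ∀ k, p (Nat.nth p k) := Nat.nth_mem_of_infinite hinf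
  have hmono : StrictMono (Nat.nth p) := Nat.nth_strictMono hinf
  have hbet : ∀ k m, Nat.nth p k < m → m < Nat.nth p (k + 1) → ¬ p m := fun k m h1 h2 h3 =>
    absurd (Nat.le_nth_of_lt_nth_succ h2 h3) (by omega)
  have hbet' : ∀ k m, Nat.nth p k < m → m < Nat.nth p (k + 1) →
      det3 (x (m - 1)) (x m) (x (m + 1)) = 0 := by
    intro k m h1 h2
    by_contra h
    exact hbet k m h1 h2 ⟨by omega, h⟩
  set C₁ := (1 + g) ^ 2 * (E + C + g * (C + D) + (Real.log 6 + C + g * (C + D)))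
  set C₂ := (1 + g) * K
  refine ⟨max C₁ (max C₂ (C + K)), fun k => x (Nat.nth p k), ?_⟩
  have m1 := le_max_left C₁ (max C₂ (C + K))
  have m2 := (le_max_left C₂ (C + K)).trans (le_max_right C₁ _)
  have m3 := (le_max_right C₂ (C + K)).trans (le_max_right C₁ _)
  exact
    { ne_zero := fun k => hx.ne_zero _
      err_pos := fun k => hepos _
      err_le_one := fun k => (hx.err_lt_one _).le
      symDet_ne_zero := fun k => hdet _
      det3_ne_zero := fun k => hx.det3_ne_zero_of_consecutive (hmono (Nat.lt_succ_self k))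
        (hmono (Nat.lt_succ_self (k + 1))) (hbet' k) (hmem _).2 (hbet' (k + 1))
      log_succ_le := fun k => by
        have := P5 _ _ (hmono (Nat.lt_succ_self k)) (hmem _) (hbet k)
        rw [hgam]
        exact this.trans (by linarith)
      le_log_succ := fun k => by
        have := P6 _ _ (hmono (Nat.lt_succ_self k)) (hmem _)
        rw [hgam]
        exact this.trans (by linarith)
      log_err_le := fun k => (P2 _ (hmem k)).trans (by linarith)
      not_proportional := fun k a b ha h => hx.not_proportional (hmono (by omega)) ha h
      tendsto := hx.tendsto_log_abs.comp hmono.tendsto_atTop }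

/-- The point attached to the symmetric matrix `y · adj(z) · y`. -/
def bracket (y z : Fin 3 → ℤ) : Fin 3 → ℤ :=
  ![y 0 ^ 2 * z 2 - 2 * y 0 * y 1 * z 1 + y 1 ^ 2 * z 0,
    y 0 * y 1 * z 2 - y 0 * y 2 * z 1 - y 1 ^ 2 * z 1 + y 1 * y 2 * z 0,
    y 1 ^ 2 * z 2 - 2 * y 1 * y 2 * z 1 + y 2 ^ 2 * z 0]

lemma symDet_bracket (y z : Fin 3 → ℤ) : symDet (bracket y z) = symDet y ^ 2 * symDet z := by
  simp only [symDet, bracket, Matrix.cons_val]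
  ring

lemma abs_mul_mul_le {a b c A B C : ℝ} (ha : |a| ≤ A) (hb : |b| ≤ B) (hc : |c| ≤ C) :
    |a * b * c| ≤ A * B * C := by
  rw [abs_mul, abs_mul]
  have := (abs_nonneg a).trans ha
  have := (abs_nonneg b).trans hb
  gcongr

lemma abs_bracket_zero_le {ξ : ℝ} {y z : Fin 3 → ℤ} (hy : y 0 ≠ 0) (hy1 : err ξ y ≤ 1) :
    |(bracket y z 0 : ℝ)| ≤ (4 * |ξ| + 3) *
      (|(y 0 : ℝ)| ^ 2 * err ξ z + |(z 0 : ℝ)| * err ξ y ^ 2) := by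
  set a := (y 0 : ℝ) * ξ - y 1 with ha
  set b := (z 0 : ℝ) * ξ - z 1 with hb
  set B := (z 0 : ℝ) * ξ ^ 2 - z 2 with hB
  have e : (bracket y z 0 : ℝ) = 2 * (ξ * (y 0 * y 0 * b)) - y 0 * y 0 * B
      - 2 * (y 0 * a * b) + z 0 * a * a := by
    simp only [bracket, Matrix.cons_val, ha, hb, hB]; push_cast; ring
  have h0 := one_le_abs_cast hy
  have ha' : |a| ≤ err ξ y := abs_le_err_one ξ y
  have hb' : |b| ≤ err ξ z := abs_le_err_one ξ z
  have hB' : |B| ≤ err ξ z := abs_le_err_two ξ z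
  have t1 := abs_mul_mul_le (le_refl |(y 0 : ℝ)|) (le_refl |(y 0 : ℝ)|) hb'
  have t2 := abs_mul_mul_le (le_refl |(y 0 : ℝ)|) (le_refl |(y 0 : ℝ)|) hB'
  have t3 := abs_mul_mul_le (le_refl |(y 0 : ℝ)|) (ha'.trans (hy1.trans h0)) hb'
  have t4 := abs_mul_mul_le (le_refl |(z 0 : ℝ)|) ha' ha'
  rw [e]
  refine (abs_add_le _ _).trans ?_
  refine (add_le_add_left ((abs_sub _ _).trans (add_le_add_left (abs_sub _ _) _)) _).trans ?_
  rw [abs_mul 2 (ξ * _), abs_mul ξ, abs_mul 2 (_ * _), abs_two]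
  have t5 := mul_le_mul_of_nonneg_left t1 (abs_nonneg ξ)
  have e1 : 0 ≤ |(y 0 : ℝ)| ^ 2 * err ξ z := mul_nonneg (by positivity) (err_nonneg _ _)
  have e2 : 0 ≤ |(z 0 : ℝ)| * err ξ y ^ 2 := by positivity
  nlinarith [mul_nonneg (abs_nonneg ξ) e1, mul_nonneg (abs_nonneg ξ) e2]

lemma err_bracket_le {ξ : ℝ} {y z : Fin 3 → ℤ} (hy : y 0 ≠ 0) (hy1 : err ξ y ≤ 1) :
    err ξ (bracket y z) ≤ (4 * |ξ| + 3) *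
      (|(y 0 : ℝ)| * err ξ y * err ξ z + |(z 0 : ℝ)| * err ξ y ^ 2) := by
  set a := (y 0 : ℝ) * ξ - y 1 with ha
  set A := (y 0 : ℝ) * ξ ^ 2 - y 2 with hA
  set b := (z 0 : ℝ) * ξ - z 1 with hb
  set B := (z 0 : ℝ) * ξ ^ 2 - z 2 with hB
  have e1 : (bracket y z 0 : ℝ) * ξ - bracket y z 1 = y 0 * A * b - y 0 * a * B
      + 2 * (ξ * (z 0 * a * a)) - z 0 * a * A - a * a * b := by
    simp only [bracket, Matrix.cons_val, ha, hA, hb, hB]; push_cast; ring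
  have e2 : (bracket y z 0 : ℝ) * ξ ^ 2 - bracket y z 2 = 2 * (ξ * (y 0 * A * b))
      - 2 * (ξ * (y 0 * a * B)) + 2 * (ξ * (z 0 * a * A)) - z 0 * A * A + a * a * B
      - 2 * (a * A * b) := by
    simp only [bracket, Matrix.cons_val, ha, hA, hb, hB]; push_cast; ring
  have h0 := one_le_abs_cast hy
  have ha' : |a| ≤ err ξ y := abs_le_err_one ξ y
  have hA' : |A| ≤ err ξ y := abs_le_err_two ξ y
  have hb' : |b| ≤ err ξ z := abs_le_err_one ξ z
  have hB' : |B| ≤ err ξ z := abs_le_err_two ξ z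
  have hY := le_refl |(y 0 : ℝ)|
  have hZ := le_refl |(z 0 : ℝ)|
  have t1 := abs_mul_mul_le hY hA' hb'
  have t2 := abs_mul_mul_le hY ha' hB'
  have t3 := abs_mul_mul_le hZ ha' ha'
  have t4 := abs_mul_mul_le hZ ha' hA'
  have t5 := abs_mul_mul_le hZ hA' hA'
  have t6 := abs_mul_mul_le (ha'.trans (hy1.trans h0)) ha' hb'
  have t7 := abs_mul_mul_le (ha'.trans (hy1.trans h0)) ha' hB'
  have t8 := abs_mul_mul_le (ha'.trans (hy1.trans h0)) hA' hb'
  have s1 := mul_le_mul_of_nonneg_left t1 (abs_nonneg ξ)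
  have s2 := mul_le_mul_of_nonneg_left t2 (abs_nonneg ξ)
  have s3 := mul_le_mul_of_nonneg_left t3 (abs_nonneg ξ)
  have s4 := mul_le_mul_of_nonneg_left t4 (abs_nonneg ξ)
  have p1 : 0 ≤ |(y 0 : ℝ)| * err ξ y * err ξ z :=
    mul_nonneg (mul_nonneg (abs_nonneg _) (err_nonneg _ _)) (err_nonneg _ _)
  have p2 : 0 ≤ |(z 0 : ℝ)| * err ξ y ^ 2 := by positivity
  have q1 := mul_nonneg (abs_nonneg ξ) p1
  have q2 := mul_nonneg (abs_nonneg ξ) p2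
  refine max_le ?_ ?_
  · rw [e1]
    refine (abs_sub _ _).trans ?_
    refine (add_le_add_left ((abs_sub _ _).trans (add_le_add_left ((abs_add_le _ _).trans
      (add_le_add_left (abs_sub _ _) _)) _)) _).trans ?_
    rw [abs_mul 2, abs_mul ξ, abs_two]
    linarith
  · rw [e2]
    refine (abs_sub _ _).trans ?_
    refine (add_le_add_left ((abs_add_le _ _).trans (add_le_add_left ((abs_sub _ _).trans
      (add_le_add_left ((abs_add_le _ _).trans
      (add_le_add_left (abs_sub _ _) _)) _)) _)) _).trans ?_
    simp only [abs_mul (2 : ℝ) (_ * _), abs_mul ξ, abs_two]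
    linarith

lemma det3_cramer (w p q r : Fin 3 → ℤ) :
    det3 p q r • w = det3 w q r • p + det3 p w r • q + det3 p q w • r := by
  funext k
  fin_cases k <;> simp only [Fin.zero_eta, Fin.mk_one, Fin.reduceFinMk, Pi.add_apply,
    Pi.smul_apply, smul_eq_mul, det3] <;> ring

namespace IsFibPoints

variable {ξ C : ℝ} {y : ℕ → Fin 3 → ℤ}

lemma const_nonneg (hy : IsFibPoints ξ C y) : 0 ≤ C := by
  linarith [hy.log_succ_le 0, hy.le_log_succ 0]

lemma abs_pos (hy : IsFibPoints ξ C y) (k : ℕ) : 0 < |(y k 0 : ℝ)| := by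
  linarith [one_le_abs_cast (hy.ne_zero k)]

lemma log_nonneg (hy : IsFibPoints ξ C y) (k : ℕ) : 0 ≤ Real.log |(y k 0 : ℝ)| :=
  Real.log_nonneg (one_le_abs_cast (hy.ne_zero k))

lemma err_le_exp (hy : IsFibPoints ξ C y) (k : ℕ) :
    err ξ (y k) ≤ Real.exp (C - Real.log |(y k 0 : ℝ)|) :=
  (Real.log_le_iff_le_exp (hy.err_pos k)).mp (hy.log_err_le k)

lemma abs_eq_exp (hy : IsFibPoints ξ C y) (k : ℕ) :
    |(y k 0 : ℝ)| = Real.exp (Real.log |(y k 0 : ℝ)|) := (Real.exp_log (hy.abs_pos k)).symm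

lemma scaled_log_bounds (hy : IsFibPoints ξ C y) (k : ℕ) :
    (2 - gam) * Real.log |(y (k + 2) 0 : ℝ)| ≤ Real.log |(y k 0 : ℝ)| + C ∧
      Real.log |(y k 0 : ℝ)| ≤ (2 - gam) * Real.log |(y (k + 2) 0 : ℝ)| + C := by
  have hg := inv_gam_sq
  have hg' := inv_gam_bounds
  rw [gam_eq]
  have a1 := hy.log_succ_le k
  have a2 := hy.log_succ_le (k + 1)
  have b1 := hy.le_log_succ k
  have b2 := hy.le_log_succ (k + 1)
  rw [gam_eq] at a1 a2 b1 b2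
  set g := 1 / gam
  set r := Real.log |(y k 0 : ℝ)|
  set s := Real.log |(y (k + 1) 0 : ℝ)|
  set t := Real.log |(y (k + 1 + 1) 0 : ℝ)| with ht
  change (2 - (1 + g)) * t ≤ r + C ∧ r ≤ (2 - (1 + g)) * t + C
  have h1 : 0 ≤ 2 - (1 + g) := by linarith
  have m1 := mul_le_mul_of_nonneg_left a2 h1
  have m2 := mul_le_mul_of_nonneg_left b2 h1
  have e1 : (2 - (1 + g)) * ((1 + g) * s) = g * s := by linear_combination -s * hg
  have g0 : 0 ≤ g := by linarith
  have m3 := mul_le_mul_of_nonneg_left a1 g0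
  have m4 := mul_le_mul_of_nonneg_left b1 g0
  have e2 : g * ((1 + g) * r) = r := by linear_combination r * hg
  constructor <;> linarith

lemma bracket_bounds (hy : IsFibPoints ξ C y) (k : ℕ) :
    |(bracket (y (k + 2)) (y (k + 3)) 0 : ℝ)| ≤
        2 * (4 * |ξ| + 3) * Real.exp (4 * C + Real.log |(y k 0 : ℝ)|) ∧
      err ξ (bracket (y (k + 2)) (y (k + 3))) ≤
        2 * (4 * |ξ| + 3) * Real.exp (4 * C - Real.log |(y k 0 : ℝ)|) := by
  have hK : 0 ≤ 4 * |ξ| + 3 := by positivity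
  obtain ⟨s1, s2⟩ := hy.scaled_log_bounds k
  have a := hy.log_succ_le (k + 2)
  have b := hy.le_log_succ (k + 2)
  have L0 := hy.err_le_exp (k + 2)
  have L1 := hy.err_le_exp (k + 3)
  have Y0 := hy.abs_eq_exp (k + 2)
  have Y1 := hy.abs_eq_exp (k + 3)
  have n0 := hy.log_nonneg (k + 2)
  have n1 := hy.log_nonneg (k + 3)
  have p0 := (hy.err_pos (k + 2)).le
  have p1 := (hy.err_pos (k + 3)).le
  have hC := hy.const_nonneg
  have hg := inv_gam_bounds
  have hgam := gam_eq
  rw [show k + 2 + 1 = k + 3 from rfl] at a b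
  have B0 := abs_bracket_zero_le (z := y (k + 3)) (hy.ne_zero (k + 2)) (hy.err_le_one (k + 2))
  have B1 := err_bracket_le (z := y (k + 3)) (hy.ne_zero (k + 2)) (hy.err_le_one (k + 2))
  rw [Y0, Y1] at B0 B1
  set r := Real.log |(y k 0 : ℝ)|
  set s := Real.log |(y (k + 2) 0 : ℝ)|
  set t := Real.log |(y (k + 3) 0 : ℝ)|
  have v1 : Real.exp t * err ξ (y (k + 2)) ^ 2 ≤ Real.exp (t + (2 * C - 2 * s)) := by
    calc _ ≤ Real.exp t * Real.exp (C - s) ^ 2 := by gcongr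
      _ = _ := by rw [← Real.exp_nat_mul, ← Real.exp_add]; congr 1; push_cast; ring
  have v2 : Real.exp s ^ 2 * err ξ (y (k + 3)) ≤ Real.exp (2 * s + (C - t)) := by
    calc _ ≤ Real.exp s ^ 2 * Real.exp (C - t) := by gcongr
      _ = _ := by rw [← Real.exp_nat_mul, ← Real.exp_add]; congr 1
  have v3 : Real.exp s * err ξ (y (k + 2)) * err ξ (y (k + 3)) ≤ Real.exp (2 * C - t) := by
    calc _ ≤ Real.exp s * Real.exp (C - s) * Real.exp (C - t) := by gcongr
      _ = _ := by rw [← Real.exp_add, ← Real.exp_add]; congr 1; ring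
  have hgs : 0 ≤ (gam - 1) * s := mul_nonneg (by linarith) n0
  have hgs' : 0 ≤ (2 - gam) * s := mul_nonneg (by linarith) n0
  have w1 : Real.exp (t + (2 * C - 2 * s)) ≤ Real.exp (4 * C - r) :=
    Real.exp_le_exp.mpr (by linarith)
  have w1' : Real.exp (t + (2 * C - 2 * s)) ≤ Real.exp (4 * C + r) :=
    Real.exp_le_exp.mpr (by linarith [hy.log_nonneg k])
  have w2 : Real.exp (2 * s + (C - t)) ≤ Real.exp (4 * C + r) :=
    Real.exp_le_exp.mpr (by linarith)
  have w3 : Real.exp (2 * C - t) ≤ Real.exp (4 * C - r) :=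
    Real.exp_le_exp.mpr (by linarith)
  constructor
  · refine B0.trans ?_
    rw [mul_comm 2, mul_assoc (4 * |ξ| + 3) 2]
    exact mul_le_mul_of_nonneg_left (by linarith) hK
  · refine B1.trans ?_
    rw [mul_comm 2, mul_assoc (4 * |ξ| + 3) 2]
    exact mul_le_mul_of_nonneg_left (by linarith) hK

end IsFibPoints

namespace IsFibPoints

variable {ξ C : ℝ} {y : ℕ → Fin 3 → ℤ}

lemma det3_bracket_bounds (hy : IsFibPoints ξ C y) (n : ℕ) :
    |(det3 (bracket (y (n + 3)) (y (n + 4))) (y (n + 1)) (y (n + 2)) : ℝ)| ≤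
        6 * (2 * (4 * |ξ| + 3) * Real.exp (4 * C)) *
          Real.exp (3 * C - Real.log |(y (n + 1) 0 : ℝ)| / 3) ∧
      |(det3 (y n) (y (n + 1)) (bracket (y (n + 3)) (y (n + 4))) : ℝ)| ≤
        6 * (2 * (4 * |ξ| + 3) * Real.exp (4 * C)) *
          Real.exp (3 * C - Real.log |(y n 0 : ℝ)| / 3) := by
  obtain ⟨b0, b1⟩ := hy.bracket_bounds (n + 1)
  change |(bracket (y (n + 3)) (y (n + 4)) 0 : ℝ)| ≤ _ at b0
  change err ξ (bracket (y (n + 3)) (y (n + 4))) ≤ _ at b1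
  have d1 := abs_det3_le ξ (bracket (y (n + 3)) (y (n + 4))) (y (n + 1)) (y (n + 2))
  have d2 := abs_det3_le ξ (y n) (y (n + 1)) (bracket (y (n + 3)) (y (n + 4)))
  have hw := err_nonneg ξ (bracket (y (n + 3)) (y (n + 4)))
  set w := bracket (y (n + 3)) (y (n + 4))
  rw [Real.exp_add, ← mul_assoc] at b0
  rw [sub_eq_add_neg, Real.exp_add, ← mul_assoc] at b1
  set M := 2 * (4 * |ξ| + 3) * Real.exp (4 * C) with hM
  have hM0 : 0 ≤ M := by positivity
  have E0 := hy.err_le_exp n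
  have E1 := hy.err_le_exp (n + 1)
  have E2 := hy.err_le_exp (n + 2)
  have p0 := (hy.err_pos n).le
  have p1 := (hy.err_pos (n + 1)).le
  have p2 := (hy.err_pos (n + 2)).le
  have n0 := hy.log_nonneg n
  have n1 := hy.log_nonneg (n + 1)
  have u0 := hy.le_log_succ n
  have u1 := hy.le_log_succ (n + 1)
  have v1 := hy.log_succ_le (n + 1)
  have hC := hy.const_nonneg
  rw [hy.abs_eq_exp (n + 1), hy.abs_eq_exp (n + 2)] at d1
  rw [hy.abs_eq_exp n, hy.abs_eq_exp (n + 1)] at d2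
  rw [show n + 1 + 1 = n + 2 from rfl] at u1 v1
  have hg := inv_gam_bounds
  have hgam := gam_eq
  set r := Real.log |(y n 0 : ℝ)|
  set s := Real.log |(y (n + 1) 0 : ℝ)|
  set u := Real.log |(y (n + 2) 0 : ℝ)|
  have g0 : r ≤ gam * r := le_mul_of_one_le_left n0 (by linarith)
  have g1 : s ≤ gam * s := le_mul_of_one_le_left n1 (by linarith)
  have g2 : gam * s ≤ 5 / 3 * s := mul_le_mul_of_nonneg_right (by linarith) n1
  have key : ∀ {a b c : ℝ} {t : ℝ}, a ≤ M * Real.exp (3 * C - t) →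
      b ≤ M * Real.exp (3 * C - t) → c ≤ M * Real.exp (3 * C - t) →
      2 * (a + b + c) ≤ 6 * M * Real.exp (3 * C - t) := fun h1 h2 h3 => by linarith
  have hexp : ∀ {a b c t : ℝ}, a + b + c ≤ t →
      M * (Real.exp a * Real.exp b * Real.exp c) ≤ M * Real.exp t := fun h => by
    rw [← Real.exp_add, ← Real.exp_add]
    exact mul_le_mul_of_nonneg_left (Real.exp_le_exp.mpr h) hM0
  constructor
  · refine d1.trans (key ?_ ?_ ?_)
    · calc _ ≤ M * Real.exp s * (Real.exp (C - s) * Real.exp (C - u)) := by gcongr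
        _ = M * (Real.exp s * Real.exp (C - s) * Real.exp (C - u)) := by ring
        _ ≤ _ := hexp (by linarith)
    · calc _ ≤ Real.exp s * (M * Real.exp (-s) * Real.exp (C - u)) := by gcongr
        _ = M * (Real.exp s * Real.exp (-s) * Real.exp (C - u)) := by ring
        _ ≤ _ := hexp (by linarith)
    · calc _ ≤ Real.exp u * (M * Real.exp (-s) * Real.exp (C - s)) := by gcongr
        _ = M * (Real.exp u * Real.exp (-s) * Real.exp (C - s)) := by ring
        _ ≤ _ := hexp (by linarith)
  · refine d2.trans (key ?_ ?_ ?_)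
    · calc _ ≤ Real.exp r * (Real.exp (C - s) * (M * Real.exp (-s))) := by gcongr
        _ = M * (Real.exp r * Real.exp (C - s) * Real.exp (-s)) := by ring
        _ ≤ _ := hexp (by linarith)
    · calc _ ≤ Real.exp s * (Real.exp (C - r) * (M * Real.exp (-s))) := by gcongr
        _ = M * (Real.exp s * Real.exp (C - r) * Real.exp (-s)) := by ring
        _ ≤ _ := hexp (by linarith)
    · calc _ ≤ M * Real.exp s * (Real.exp (C - r) * Real.exp (C - s)) := by gcongr
        _ = M * (Real.exp s * Real.exp (C - r) * Real.exp (C - s)) := by ring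
        _ ≤ _ := hexp (by linarith)

lemma eventually_bracket (hy : IsFibPoints ξ C y) : ∃ n₀, ∀ n, n₀ ≤ n →
    ∃ a b : ℤ, a ≠ 0 ∧ b ≠ 0 ∧ a • bracket (y (n + 3)) (y (n + 4)) = b • y (n + 1) := by
  set M := 6 * (2 * (4 * |ξ| + 3) * Real.exp (4 * C)) with hM
  have hM0 : 0 < M := by positivity
  obtain ⟨n₀, h₀⟩ := Filter.eventually_atTop.mp
    (hy.tendsto.eventually_gt_atTop (3 * (3 * C + Real.log M)))
  have hlt : ∀ n, n₀ ≤ n → M * Real.exp (3 * C - Real.log |(y n 0 : ℝ)| / 3) < 1 := by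
    intro n hn
    rw [← Real.log_neg_iff (by positivity), Real.log_mul hM0.ne' (Real.exp_pos _).ne',
      Real.log_exp]
    linarith [h₀ n hn]
  have hz : ∀ m : ℤ, |(m : ℝ)| < 1 → m = 0 := fun m hm => by
    by_contra h
    linarith [one_le_abs_cast h]
  refine ⟨n₀, fun n hn => ?_⟩
  obtain ⟨d1, d2⟩ := hy.det3_bracket_bounds n
  have z1 := hz _ (d1.trans_lt (hlt (n + 1) (by omega)))
  have z2 := hz _ (d2.trans_lt (hlt n hn))
  have hc := det3_cramer (bracket (y (n + 3)) (y (n + 4))) (y n) (y (n + 1)) (y (n + 2))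
  rw [z1, z2, zero_smul, zero_smul, zero_add, add_zero] at hc
  refine ⟨_, _, hy.det3_ne_zero n, fun hb => ?_, hc⟩
  rw [hb, zero_smul, smul_eq_zero, or_iff_right (hy.det3_ne_zero n)] at hc
  have hs := symDet_bracket (y (n + 3)) (y (n + 4))
  rw [hc] at hs
  refine mul_ne_zero (pow_ne_zero 2 (hy.symDet_ne_zero (n + 3))) (hy.symDet_ne_zero (n + 4))
    (hs.symm.trans ?_)
  simp [symDet]

end IsFibPoints

lemma IsExtremal.exists_isFibPoints_bracket {ξ : ℝ} (hξ : IsExtremal ξ) :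
    ∃ C y, IsFibPoints ξ C y ∧ ∀ k, ∃ a b : ℤ, a ≠ 0 ∧ b ≠ 0 ∧
      a • bracket (y (k + 2)) (y (k + 3)) = b • y k := by
  obtain ⟨C, y, hy⟩ := hξ.exists_isFibPoints
  obtain ⟨n₀, hn⟩ := hy.eventually_bracket
  refine ⟨C, _, hy.shift (n₀ + 1), fun k => ?_⟩
  have h := hn (k + n₀) (by omega)
  rwa [show k + n₀ + 3 = k + 2 + (n₀ + 1) by ring, show k + n₀ + 4 = k + 3 + (n₀ + 1) by ring]
    at h

/-- The symmetric matrix attached to an integer point. -/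
def sym (x : Fin 3 → ℤ) : M2 := !![x 0, x 1; x 1, x 2]

lemma sym_transpose (x : Fin 3 → ℤ) : (sym x)ᵀ = sym x := by
  ext i j
  fin_cases i <;> fin_cases j <;> rfl

lemma det_sym (x : Fin 3 → ℤ) : (sym x).det = symDet x := by
  simp only [sym, Matrix.det_fin_two_of, symDet]
  ring

lemma sym_bracket (y z : Fin 3 → ℤ) :
    sym (bracket y z) = sym y * (sym z).adjugate * sym y := by
  ext i j
  fin_cases i <;> fin_cases j <;>
    simp only [sym, bracket, Matrix.cons_val, Matrix.adjugate_fin_two_of, Matrix.mul_apply,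
      Fin.sum_univ_two, Matrix.of_apply, Matrix.cons_val', Fin.zero_eta, Fin.mk_one] <;> ring

lemma smul_sym (a : ℤ) (x : Fin 3 → ℤ) : a • sym x = sym (a • x) := by
  ext i j
  fin_cases i <;> fin_cases j <;> rfl

lemma sym_injective : Function.Injective sym := fun x y h => by
  funext i
  fin_cases i
  · exact congrFun (congrFun h 0) 0
  · exact congrFun (congrFun h 0) 1
  · exact congrFun (congrFun h 1) 1

lemma adjugate_adjugate_two (A : M2) : A.adjugate.adjugate = A := by
  rw [Matrix.adjugate_adjugate', Fintype.card_fin, Nat.sub_self, pow_zero, one_smul]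

lemma adjugate_mul_mul_adjugate_of_skew {N S : M2} (hN : N = -Nᵀ) (hS : Sᵀ = S) :
    N.adjugate * (S * N.adjugate) = (-N.det) • S.adjugate := by
  have h0 := congrFun (congrFun hN 0) 0
  have h1 := congrFun (congrFun hN 1) 1
  have h2 := congrFun (congrFun hN 0) 1
  have h3 := congrFun (congrFun hS 0) 1
  simp only [Matrix.neg_apply, Matrix.transpose_apply] at h0 h1 h2 h3
  replace h0 : N 0 0 = 0 := by omega
  replace h1 : N 1 1 = 0 := by omega
  ext i j
  fin_cases i <;> fin_cases j <;>
    simp only [Matrix.adjugate_fin_two, Matrix.det_fin_two, Matrix.mul_apply, Matrix.smul_apply,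
      Fin.sum_univ_two, Matrix.of_apply, Matrix.cons_val', Matrix.cons_val, Fin.zero_eta,
      Fin.mk_one, smul_eq_mul, h0, h1, h2, h3] <;> ring

/-- Proportionality of integer matrices. -/
def Par (A B : M2) : Prop := ∃ a b : ℤ, a ≠ 0 ∧ b ≠ 0 ∧ a • A = b • B

namespace Par

variable {A B C D : M2}

lemma refl (A : M2) : Par A A := ⟨1, 1, one_ne_zero, one_ne_zero, rfl⟩

lemma symm : Par A B → Par B A := fun ⟨a, b, ha, hb, h⟩ => ⟨b, a, hb, ha, h.symm⟩

lemma trans : Par A B → Par B C → Par A C := fun ⟨a, b, ha, hb, h⟩ ⟨c, d, hc, hd, k⟩ =>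
  ⟨c * a, b * d, mul_ne_zero hc ha, mul_ne_zero hb hd, by
    rw [mul_smul, h, smul_comm, k, mul_smul]⟩

lemma mul : Par A B → Par C D → Par (A * C) (B * D) := fun ⟨a, b, ha, hb, h⟩ ⟨c, d, hc, hd, k⟩ =>
  ⟨a * c, b * d, mul_ne_zero ha hc, mul_ne_zero hb hd, by
    rw [← smul_mul_smul_comm, h, k, smul_mul_smul_comm]⟩

lemma mul_left (A : M2) (h : Par B C) : Par (A * B) (A * C) := (refl A).mul h

lemma mul_right (h : Par A B) (C : M2) : Par (A * C) (B * C) := h.mul (refl C)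

lemma transpose : Par A B → Par Aᵀ Bᵀ := fun ⟨a, b, ha, hb, h⟩ =>
  ⟨a, b, ha, hb, by rw [← Matrix.transpose_smul, h, Matrix.transpose_smul]⟩

lemma adjugate : Par A B → Par A.adjugate B.adjugate := fun ⟨a, b, ha, hb, h⟩ =>
  ⟨a, b, ha, hb, by
    have := congrArg Matrix.adjugate h
    simpa only [Matrix.adjugate_smul, Fintype.card_fin, Nat.add_one_sub_one, pow_one] using this⟩

lemma smul_self {c : ℤ} (hc : c ≠ 0) (A : M2) : Par (c • A) A :=
  ⟨1, c, one_ne_zero, hc, one_smul _ _⟩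

lemma adjugate_mul_cancel (hA : A.det ≠ 0) (B : M2) : Par (A.adjugate * (A * B)) B := by
  rw [← Matrix.mul_assoc, Matrix.adjugate_mul, Matrix.smul_mul, Matrix.one_mul]
  exact smul_self hA B

lemma mul_adjugate_cancel (hA : A.det ≠ 0) (B : M2) : Par (A * (A.adjugate * B)) B := by
  rw [← Matrix.mul_assoc, Matrix.mul_adjugate, Matrix.smul_mul, Matrix.one_mul]
  exact smul_self hA B

lemma mul_adjugate_mul_cancel (hA : A.det ≠ 0) (B : M2) : Par (B * (A.adjugate * A)) B := by
  rw [Matrix.adjugate_mul, Matrix.mul_smul, Matrix.mul_one]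
  exact smul_self hA B

lemma det_ne_zero (h : Par A B) (hB : B.det ≠ 0) : A.det ≠ 0 := by
  obtain ⟨a, b, -, hb, h⟩ := h
  have hd := congrArg Matrix.det h
  rw [Matrix.det_smul, Matrix.det_smul] at hd
  intro h0
  rw [h0, mul_zero] at hd
  exact mul_ne_zero (pow_ne_zero _ hb) hB hd.symm

lemma isSymm (h : Par A B) (hB : B.IsSymm) : A.IsSymm := by
  obtain ⟨a, b, ha, -, h⟩ := h
  refine smul_right_injective _ ha ?_
  change a • Aᵀ = a • A
  rw [← Matrix.transpose_smul, h, Matrix.transpose_smul, hB.eq]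

end Par

lemma content_dvd (A : M2) (i j : Fin 2) : (content A : ℤ) ∣ A i j := by
  rw [Int.natCast_dvd]
  fin_cases i <;> fin_cases j
  · exact (Nat.gcd_dvd_left _ _).trans (Nat.gcd_dvd_left _ _)
  · exact (Nat.gcd_dvd_left _ _).trans (Nat.gcd_dvd_right _ _)
  · exact (Nat.gcd_dvd_right _ _).trans (Nat.gcd_dvd_left _ _)
  · exact (Nat.gcd_dvd_right _ _).trans (Nat.gcd_dvd_right _ _)

lemma content_smul (a : ℤ) (A : M2) : content (a • A) = a.natAbs * content A := by
  simp only [content, Matrix.smul_apply, smul_eq_mul, Int.natAbs_mul, Nat.gcd_mul_left]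

lemma content_smul_red (A : M2) : (content A : ℤ) • red A = A := by
  ext i j
  exact Int.mul_ediv_cancel' (content_dvd A i j)

lemma content_ne_zero {A : M2} (hA : A.det ≠ 0) : content A ≠ 0 := by
  intro h
  apply hA
  rw [← content_smul_red A, h, Nat.cast_zero, zero_smul, Matrix.det_zero]

lemma par_red {A : M2} (hA : A.det ≠ 0) : Par (red A) A :=
  ⟨content A, 1, by exact_mod_cast content_ne_zero hA, one_ne_zero, by
    rw [content_smul_red, one_smul]⟩

lemma memP_red {A : M2} (hA : A.det ≠ 0) : MemP (red A) := by
  refine ⟨?_, (par_red hA).det_ne_zero hA⟩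
  have h := congrArg content (content_smul_red A)
  rw [content_smul, Int.natAbs_natCast] at h
  exact Nat.eq_of_mul_eq_mul_left (Nat.pos_of_ne_zero (content_ne_zero hA))
    (h.trans (mul_one _).symm)

lemma Par.exists_eq_smul {A B : M2} (h : Par A B) (hA : Primitive A) :
    ∃ g : ℤ, g ≠ 0 ∧ B = g • A := by
  obtain ⟨a, b, ha, hb, h⟩ := h
  have hc := congrArg content h
  rw [content_smul, content_smul, hA, mul_one] at hc
  obtain ⟨g, rfl⟩ : b ∣ a := Int.natAbs_dvd_natAbs.mp ⟨_, hc⟩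
  rw [mul_smul] at h
  exact ⟨g, right_ne_zero_of_mul ha, (smul_right_injective _ hb h).symm⟩

/-- The matrix `N_i`: the transpose of `N` for odd `i`, and `N` for even `i`. -/
def alt (N : M2) (i : ℕ) : M2 := if i % 2 = 1 then Nᵀ else N

lemma alt_succ (N : M2) (i : ℕ) : alt N (i + 1) = (alt N i)ᵀ := by
  rcases Nat.mod_two_eq_zero_or_one i with h | h
  · rw [alt, alt, if_pos (by omega), if_neg (by omega)]
  · rw [alt, alt, if_neg (by omega), if_pos h, Matrix.transpose_transpose]

lemma alt_add_two (N : M2) (i : ℕ) : alt N (i + 2) = alt N i := by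
  rw [alt_succ, alt_succ, Matrix.transpose_transpose]

lemma det_alt (N : M2) (i : ℕ) : (alt N i).det = N.det := by
  rw [alt]
  split_ifs
  · exact Matrix.det_transpose N
  · rfl

/-- The Fibonacci sequence in `𝒫` with given first two terms. -/
def fibP (A B : M2) : ℕ → M2
  | 0 => 0
  | 1 => A
  | 2 => B
  | n + 3 => pmul (fibP A B (n + 2)) (fibP A B (n + 1))

/-- A sequence of integer points whose symmetric matrices satisfy the recurrence relation
`Y_k ∼ Y_{k+2} adj(Y_{k+3}) Y_{k+2}`. -/
structure IsSymRec (y : ℕ → Fin 3 → ℤ) : Prop where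
  det_ne_zero : ∀ k, (sym (y k)).det ≠ 0
  par : ∀ k, Par (sym (y (k + 2)) * (sym (y (k + 3))).adjugate * sym (y (k + 2))) (sym (y k))

namespace IsSymRec

variable {y : ℕ → Fin 3 → ℤ} {N : M2}

lemma par_succ (hy : IsSymRec y) (k : ℕ) :
    Par (sym (y (k + 3))) (sym (y (k + 2)) * ((sym (y k)).adjugate * sym (y (k + 2)))) := by
  have h := (hy.par k).adjugate
  rw [Matrix.adjugate_mul_distrib, Matrix.adjugate_mul_distrib, adjugate_adjugate_two] at h
  have h2 := ((h.mul_right (sym (y (k + 2)))).mul_left (sym (y (k + 2))))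
  simp only [Matrix.mul_assoc] at h2
  exact ((Par.mul_adjugate_mul_cancel (hy.det_ne_zero _) _).symm.trans
    (Par.mul_adjugate_cancel (hy.det_ne_zero _) _).symm).trans h2

lemma par_alt_zero (hy : IsSymRec y)
    (hN : Par Nᵀ (sym (y 0) * ((sym (y 2)).adjugate * sym (y 1)))) :
    Par (sym (y 2)) (sym (y 1) * ((alt N 1).adjugate * sym (y 0))) := by
  have h := hN.adjugate
  rw [Matrix.adjugate_mul_distrib, Matrix.adjugate_mul_distrib, adjugate_adjugate_two] at h
  have h2 := ((h.mul_right (sym (y 0))).mul_left (sym (y 1)))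
  simp only [Matrix.mul_assoc] at h2
  exact (h2.trans ((Par.mul_adjugate_cancel (hy.det_ne_zero _) _).trans
    (Par.mul_adjugate_mul_cancel (hy.det_ne_zero _) _))).symm

lemma par_transpose {k i : ℕ}
    (h : Par (sym (y (k + 2))) (sym (y (k + 1)) * ((alt N i).adjugate * sym (y k)))) :
    Par (sym (y (k + 2))) (sym (y k) * ((alt N (i + 1)).adjugate * sym (y (k + 1)))) := by
  have h2 := h.transpose
  rwa [Matrix.transpose_mul, Matrix.transpose_mul, Matrix.adjugate_transpose, sym_transpose,
    sym_transpose, sym_transpose, ← alt_succ, Matrix.mul_assoc] at h2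

lemma par_alt (hy : IsSymRec y)
    (hN : Par Nᵀ (sym (y 0) * ((sym (y 2)).adjugate * sym (y 1)))) (k : ℕ) :
    Par (sym (y (k + 2))) (sym (y (k + 1)) * ((alt N (k + 1)).adjugate * sym (y k))) := by
  induction k with
  | zero => exact hy.par_alt_zero hN
  | succ k ih =>
    refine (hy.par_succ k).trans (Par.mul_left _ ?_)
    exact ((par_transpose ih).mul_left _).trans (Par.adjugate_mul_cancel (hy.det_ne_zero _) _)

lemma par_of_skew (hy : IsSymRec y)
    (hN : Par Nᵀ (sym (y 0) * ((sym (y 2)).adjugate * sym (y 1)))) (hdet : N.det ≠ 0)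
    (hskew : N = -Nᵀ) : Par (sym (y 3)) (sym (y 0)) := by
  have h1 := (hy.par_alt hN 1).trans ((par_transpose (hy.par_alt hN 0)).mul_right _)
  have h2 : alt N 2 = N := rfl
  simp only [zero_add, one_add_one_eq_two, h2, Matrix.mul_assoc] at h1
  have h3 := adjugate_mul_mul_adjugate_of_skew hskew (sym_transpose (y 1))
  have h4 : N.adjugate * (sym (y 1) * (N.adjugate * sym (y 1))) =
      (-N.det) • (sym (y 1)).adjugate * sym (y 1) := by
    rw [← h3]
    simp only [Matrix.mul_assoc]
  rw [h4] at h1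
  refine h1.trans ((((Par.smul_self (neg_ne_zero.mpr hdet) _).mul_right _).mul_left _).trans
    (Par.mul_adjugate_mul_cancel (hy.det_ne_zero _) _))

lemma fibP_spec (hy : IsSymRec y)
    (hN : Par Nᵀ (sym (y 0) * ((sym (y 2)).adjugate * sym (y 1)))) (hdet : N.det ≠ 0) (i : ℕ) :
    ∀ j, j = i + 1 ∨ j = i + 2 →
    MemP (fibP (red (sym (y 1) * (alt N 1).adjugate)) (red (sym (y 2) * (alt N 2).adjugate)) j) ∧
      Par (fibP (red (sym (y 1) * (alt N 1).adjugate)) (red (sym (y 2) * (alt N 2).adjugate)) j)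
        (sym (y j) * (alt N j).adjugate) := by
  have hd : ∀ j, (sym (y j) * (alt N j).adjugate).det ≠ 0 := fun j => by
    rw [Matrix.det_mul, Matrix.det_adjugate, det_alt]
    exact mul_ne_zero (hy.det_ne_zero j) (pow_ne_zero _ hdet)
  induction i with
  | zero =>
    rintro j (rfl | rfl)
    · exact ⟨memP_red (hd 1), par_red (hd 1)⟩
    · exact ⟨memP_red (hd 2), par_red (hd 2)⟩
  | succ i ih =>
    rintro j (rfl | rfl)
    · exact ih _ (Or.inr rfl)
    · obtain ⟨m1, p1⟩ := ih (i + 1) (Or.inl rfl)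
      obtain ⟨m2, p2⟩ := ih (i + 2) (Or.inr rfl)
      have hm := mul_ne_zero m2.2 m1.2
      rw [← Matrix.det_mul] at hm
      refine ⟨memP_red hm, (par_red hm).trans ((p2.mul p1).trans ?_)⟩
      have h := ((hy.par_alt hN (i + 1)).mul_right (alt N (i + 1)).adjugate).symm
      rw [alt_add_two N (i + 1)]
      simpa only [Matrix.mul_assoc] using h

end IsSymRec

lemma det_alt_source (x y z : Fin 3 → ℤ) :
    (sym x * ((sym z).adjugate * sym y)) 0 1 - (sym x * ((sym z).adjugate * sym y)) 1 0 =
      det3 x y z := by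
  simp only [sym, det3, Matrix.cons_val, Matrix.adjugate_fin_two_of, Matrix.mul_apply,
      Fin.sum_univ_two, Matrix.of_apply, Matrix.cons_val']
  ring

lemma IsSymRec.exists_isFibP {y : ℕ → Fin 3 → ℤ} (hy : IsSymRec y)
    (h3 : det3 (y 0) (y 1) (y 2) ≠ 0) (hpar : ¬ Par (sym (y 3)) (sym (y 0))) :
    ∃ N W, MemP N ∧ N ≠ Nᵀ ∧ N ≠ -Nᵀ ∧ IsFibP W ∧
      ∀ i, 1 ≤ i → MemP (W i) ∧ Par (W i) (sym (y i) * (alt N i).adjugate) := by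
  set T := sym (y 0) * ((sym (y 2)).adjugate * sym (y 1)) with hT
  have hTdet : (Tᵀ).det ≠ 0 := by
    rw [Matrix.det_transpose, hT, Matrix.det_mul, Matrix.det_mul, Matrix.det_adjugate]
    exact mul_ne_zero (hy.det_ne_zero _)
      (mul_ne_zero (pow_ne_zero _ (hy.det_ne_zero _)) (hy.det_ne_zero _))
  have hN : Par (red Tᵀ)ᵀ T := by
    simpa only [Matrix.transpose_transpose] using (par_red hTdet).transpose
  have hNP := memP_red hTdet
  have hW := fun i => hy.fibP_spec hN hNP.2 i
  refine ⟨red Tᵀ, _, hNP, fun h => h3 ?_, fun h => hpar (hy.par_of_skew hN hNP.2 h),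
    ⟨fun i hi => (hW (i - 1) i (by omega)).1, fun i hi => ?_⟩, fun i hi => hW (i - 1) i (by omega)⟩
  · have hs : T.IsSymm := hN.symm.isSymm (by rw [← h]; exact h.symm)
    rw [← det_alt_source, sub_eq_zero]
    exact (hs.apply 0 1).symm
  · obtain ⟨n, rfl⟩ : ∃ n, i = n + 1 := ⟨i - 1, by omega⟩
    rfl

section Norms

variable {ξ : ℝ} {A B : M2}

lemma abs_apply_le_mnorm (A : M2) (i j : Fin 2) : |(A i j : ℝ)| ≤ mnorm A := by
  rw [mnorm]
  fin_cases i <;> fin_cases j <;> simp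

lemma mnorm_le {c : ℝ} (h : ∀ i j, |(A i j : ℝ)| ≤ c) : mnorm A ≤ c :=
  max_le (max_le (h _ _) (h _ _)) (max_le (h _ _) (h _ _))

lemma mnorm_nonneg (A : M2) : 0 ≤ mnorm A := (abs_nonneg _).trans (abs_apply_le_mnorm A 0 0)

lemma mnorm_smul (c : ℤ) (A : M2) : mnorm (c • A) = |(c : ℝ)| * mnorm A := by
  simp only [mnorm, Matrix.smul_apply, smul_eq_mul, Int.cast_mul, abs_mul,
    mul_max_of_nonneg _ _ (abs_nonneg (c : ℝ))]

lemma mnorm_transpose (A : M2) : mnorm Aᵀ = mnorm A := by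
  simp only [mnorm, Matrix.transpose_apply]
  rw [max_max_max_comm]

lemma mnorm_adjugate (A : M2) : mnorm A.adjugate = mnorm A := by
  simp only [mnorm, Matrix.adjugate_fin_two, Matrix.of_apply, Matrix.cons_val', Matrix.cons_val,
    Int.cast_neg, abs_neg]
  rw [max_comm (max _ _), max_comm |(A 1 0 : ℝ)|, max_comm |(A 1 1 : ℝ)|, max_max_max_comm]

lemma mnorm_mul_le (A B : M2) : mnorm (A * B) ≤ 2 * (mnorm A * mnorm B) := by
  refine mnorm_le fun i j => ?_
  rw [Matrix.mul_apply, Fin.sum_univ_two]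
  push_cast
  refine (abs_add_le _ _).trans ?_
  rw [abs_mul, abs_mul, two_mul]
  have := mnorm_nonneg A
  gcongr <;> apply abs_apply_le_mnorm

lemma mnorm_alt (N : M2) (i : ℕ) : mnorm (alt N i) = mnorm N := by
  rw [alt]
  split_ifs
  · exact mnorm_transpose N
  · rfl

lemma xiNorm_nonneg (ξ : ℝ) (A : M2) : 0 ≤ xiNorm ξ A := (abs_nonneg _).trans (le_max_left _ _)

lemma xiNorm_smul (ξ : ℝ) (c : ℤ) (A : M2) : xiNorm ξ (c • A) = |(c : ℝ)| * xiNorm ξ A := by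
  simp only [xiNorm, Matrix.smul_apply, smul_eq_mul, Int.cast_mul, mul_left_comm ξ, ← mul_sub,
    abs_mul, mul_max_of_nonneg _ _ (abs_nonneg (c : ℝ))]

lemma xiNorm_mul_le (ξ : ℝ) (A B : M2) : xiNorm ξ (A * B) ≤ 2 * (xiNorm ξ A * mnorm B) := by
  have key : ∀ j, |ξ * ((A * B) 0 j : ℝ) - ((A * B) 1 j : ℝ)| ≤ 2 * (xiNorm ξ A * mnorm B) := by
    intro j
    have h : ξ * ((A * B) 0 j : ℝ) - ((A * B) 1 j : ℝ) =
        (ξ * A 0 0 - A 1 0) * B 0 j + (ξ * A 0 1 - A 1 1) * B 1 j := by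
      rw [Matrix.mul_apply, Matrix.mul_apply, Fin.sum_univ_two, Fin.sum_univ_two]
      push_cast
      ring
    rw [h]
    refine (abs_add_le _ _).trans ?_
    rw [abs_mul, abs_mul, two_mul]
    have := xiNorm_nonneg ξ A
    gcongr
    · exact le_max_left _ _
    · apply abs_apply_le_mnorm
    · exact le_max_right _ _
    · apply abs_apply_le_mnorm
  exact max_le (key 0) (key 1)

lemma abs_det_le_mnorm_mul_xiNorm (ξ : ℝ) (A : M2) :
    |(A.det : ℝ)| ≤ 2 * (mnorm A * xiNorm ξ A) := by
  have h : (A.det : ℝ) = A 0 1 * (ξ * A 0 0 - A 1 0) - A 0 0 * (ξ * A 0 1 - A 1 1) := by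
    rw [Matrix.det_fin_two]
    push_cast
    ring
  rw [h]
  refine (abs_sub _ _).trans ?_
  rw [abs_mul, abs_mul, two_mul]
  have := mnorm_nonneg A
  gcongr
  · apply abs_apply_le_mnorm
  · exact le_max_left _ _
  · apply abs_apply_le_mnorm
  · exact le_max_right _ _

lemma abs_zero_le_mnorm_sym (x : Fin 3 → ℤ) : |(x 0 : ℝ)| ≤ mnorm (sym x) :=
  abs_apply_le_mnorm (sym x) 0 0

lemma xiNorm_sym_le (ξ : ℝ) (x : Fin 3 → ℤ) : xiNorm ξ (sym x) ≤ (1 + |ξ|) * err ξ x := by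
  have h1 := abs_le_err_one ξ x
  have h2 := abs_le_err_two ξ x
  have h0 := mul_nonneg (abs_nonneg ξ) (err_nonneg ξ x)
  refine max_le ?_ ?_
  · change |ξ * (x 0 : ℝ) - x 1| ≤ _
    rw [mul_comm ξ]
    linarith
  · change |ξ * (x 1 : ℝ) - x 2| ≤ _
    rw [show ξ * (x 1 : ℝ) - x 2 = (x 0 * ξ ^ 2 - x 2) - ξ * (x 0 * ξ - x 1) by ring]
    refine (abs_sub _ _).trans ?_
    rw [abs_mul ξ]
    linarith [mul_le_mul_of_nonneg_left h1 (abs_nonneg ξ)]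

lemma mnorm_sym_le {x : Fin 3 → ℤ} (h0 : x 0 ≠ 0) (h1 : err ξ x ≤ 1) :
    mnorm (sym x) ≤ (1 + |ξ| + ξ ^ 2) * |(x 0 : ℝ)| := by
  have hx := one_le_abs_cast h0
  have e1 := (abs_le_err_one ξ x).trans h1
  have e2 := (abs_le_err_two ξ x).trans h1
  have n1 := mul_nonneg (abs_nonneg ξ) (abs_nonneg (x 0 : ℝ))
  have n2 := mul_nonneg (sq_nonneg ξ) (abs_nonneg (x 0 : ℝ))
  have b1 : |(x 1 : ℝ)| ≤ (1 + |ξ| + ξ ^ 2) * |(x 0 : ℝ)| := by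
    rw [show (x 1 : ℝ) = x 0 * ξ - (x 0 * ξ - x 1) by ring]
    refine (abs_sub _ _).trans ?_
    rw [abs_mul]
    linarith
  have b2 : |(x 2 : ℝ)| ≤ (1 + |ξ| + ξ ^ 2) * |(x 0 : ℝ)| := by
    rw [show (x 2 : ℝ) = x 0 * ξ ^ 2 - (x 0 * ξ ^ 2 - x 2) by ring]
    refine (abs_sub _ _).trans ?_
    rw [abs_mul, abs_of_nonneg (sq_nonneg ξ)]
    linarith
  have b0 : |(x 0 : ℝ)| ≤ (1 + |ξ| + ξ ^ 2) * |(x 0 : ℝ)| := by linarith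
  exact max_le (max_le b0 b1) (max_le b1 b2)

end Norms

/-- Comparison of a primitive matrix `W` with an integer point `x` whose symmetric matrix is
proportional to `W * M`. -/
lemma Par.norm_bounds {ξ : ℝ} {x : Fin 3 → ℤ} {W M : M2} (h : Par W (sym x * M.adjugate))
    (hW : MemP W) (hM : M.det ≠ 0) (h0 : x 0 ≠ 0) (h1 : err ξ x ≤ 1) :
    mnorm W ≤ 2 * (1 + |ξ| + ξ ^ 2) * mnorm M * |(x 0 : ℝ)| ∧
      |(x 0 : ℝ)| ≤ 2 * |((sym x).det : ℝ)| * |(M.det : ℝ)| * mnorm M * mnorm W ∧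
      xiNorm ξ W ≤ 2 * (1 + |ξ|) * mnorm M * err ξ x ∧
      |(W.det : ℝ)| ≤ |((sym x).det : ℝ)| * |(M.det : ℝ)| := by
  obtain ⟨g, hg, h⟩ := h.exists_eq_smul hW.1
  have hg1 := one_le_abs_cast hg
  have hM1 := one_le_abs_cast hM
  have hW1 := one_le_abs_cast hW.2
  have hn := mnorm_nonneg M
  have hnW := mnorm_nonneg W
  have hdet : |((sym x).det : ℝ)| * |(M.det : ℝ)| = |(g : ℝ)| ^ 2 * |(W.det : ℝ)| := by
    have hd := congrArg Matrix.det h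
    rw [Matrix.det_mul, Matrix.det_adjugate, Matrix.det_smul, Fintype.card_fin, pow_one] at hd
    rw [← abs_mul, ← abs_pow, ← abs_mul]
    exact_mod_cast congrArg abs hd
  refine ⟨?_, ?_, ?_, ?_⟩
  · have e := congrArg mnorm h
    have h2 := mnorm_mul_le (sym x) M.adjugate
    rw [mnorm_adjugate] at h2
    rw [mnorm_smul] at e
    calc mnorm W ≤ |(g : ℝ)| * mnorm W := le_mul_of_one_le_left hnW hg1
      _ ≤ 2 * (mnorm (sym x) * mnorm M) := e ▸ h2
      _ ≤ 2 * ((1 + |ξ| + ξ ^ 2) * |(x 0 : ℝ)| * mnorm M) := by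
        gcongr
        exact mnorm_sym_le h0 h1
      _ = _ := by ring
  · have e := congrArg (fun A : M2 => mnorm (A * M)) h
    simp only [Matrix.mul_assoc, Matrix.adjugate_mul, Matrix.mul_smul, Matrix.smul_mul, mnorm_smul,
      Matrix.mul_one] at e
    calc |(x 0 : ℝ)| ≤ mnorm (sym x) := abs_zero_le_mnorm_sym x
      _ ≤ |(M.det : ℝ)| * mnorm (sym x) := le_mul_of_one_le_left (mnorm_nonneg _) hM1
      _ = |(g : ℝ)| * mnorm (W * M) := e
      _ ≤ (|(g : ℝ)| ^ 2 * |(W.det : ℝ)|) * (2 * (mnorm W * mnorm M)) := by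
        refine mul_le_mul ?_ (mnorm_mul_le _ _) (mnorm_nonneg _) (by positivity)
        nlinarith [mul_nonneg (abs_nonneg (g : ℝ)) (abs_nonneg (g : ℝ))]
      _ = _ := by rw [← hdet]; ring
  · have e := congrArg (xiNorm ξ) h
    have h2 := xiNorm_mul_le ξ (sym x) M.adjugate
    rw [mnorm_adjugate] at h2
    rw [xiNorm_smul] at e
    calc xiNorm ξ W ≤ |(g : ℝ)| * xiNorm ξ W := le_mul_of_one_le_left (xiNorm_nonneg _ _) hg1
      _ ≤ 2 * (xiNorm ξ (sym x) * mnorm M) := e ▸ h2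
      _ ≤ 2 * ((1 + |ξ|) * err ξ x * mnorm M) := by
        gcongr
        exact xiNorm_sym_le ξ x
      _ = _ := by ring
  · rw [hdet]
    exact le_mul_of_one_le_left (abs_nonneg _) (one_le_pow₀ hg1)

namespace IsFibPoints

variable {ξ C : ℝ} {y : ℕ → Fin 3 → ℤ}

lemma rpow_bounds (hy : IsFibPoints ξ C y) (k : ℕ) :
    |(y (k + 1) 0 : ℝ)| ≤ Real.exp C * |(y k 0 : ℝ)| ^ gam ∧
      |(y k 0 : ℝ)| ^ gam ≤ Real.exp C * |(y (k + 1) 0 : ℝ)| := by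
  rw [Real.rpow_def_of_pos (hy.abs_pos k), ← Real.exp_add]
  constructor
  · rw [← Real.log_le_iff_le_exp (hy.abs_pos _)]
    linarith [hy.log_succ_le k]
  · calc _ ≤ Real.exp (C + Real.log |(y (k + 1) 0 : ℝ)|) :=
        Real.exp_le_exp.mpr (by linarith [hy.le_log_succ k])
      _ = _ := by rw [Real.exp_add, Real.exp_log (hy.abs_pos _)]

lemma isAssociated_of_bounds (hy : IsFibPoints ξ C y) {W : ℕ → M2} (hW : IsFibP W)
    (hadm : AdmissibleFib W) {a b c d : ℝ} (ha : 0 < a) (hb : 0 < b) (hc : 0 < c) (hd : 0 < d)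
    (h1 : ∀ i, 1 ≤ i → mnorm (W i) ≤ a * |(y i 0 : ℝ)|)
    (h2 : ∀ i, 1 ≤ i → |(y i 0 : ℝ)| ≤ b * mnorm (W i))
    (h3 : ∀ i, 1 ≤ i → xiNorm ξ (W i) ≤ c * err ξ (y i))
    (h4 : ∀ i, 1 ≤ i → |((W i).det : ℝ)| ≤ d) : IsAssociated ξ W := by
  have hpos : ∀ i, 1 ≤ i → 0 < mnorm (W i) := fun i hi =>
    pos_of_mul_pos_right ((hy.abs_pos i).trans_le (h2 i hi)) hb.le
  have hg : 0 ≤ gam := gam_pos.le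
  have hC := Real.exp_pos C
  refine ⟨hW, fun M => ?_, hadm, (a ^ gam * Real.exp C * b)⁻¹, a * Real.exp C * b ^ gam, 1 / 2,
    c * Real.exp C * a, 1, d, by positivity, by positivity, by norm_num, by positivity,
    one_pos, hd, fun i hi => ⟨?_, ?_, ?_, ?_, one_le_abs_cast (hW.1 i hi).2, h4 i hi⟩⟩
  · obtain ⟨i, hi, hM⟩ := ((Filter.eventually_ge_atTop 1).and
      (hy.tendsto.eventually_gt_atTop (b * M))).exists
    refine ⟨i, hi, lt_of_mul_lt_mul_left (hM.trans_le ?_) hb.le⟩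
    exact (Real.log_le_self (abs_nonneg _)).trans (h2 i hi)
  · rw [inv_mul_le_iff₀ (by positivity)]
    calc mnorm (W i) ^ gam ≤ (a * |(y i 0 : ℝ)|) ^ gam :=
          Real.rpow_le_rpow (hpos i hi).le (h1 i hi) hg
      _ = a ^ gam * |(y i 0 : ℝ)| ^ gam := Real.mul_rpow ha.le (abs_nonneg _)
      _ ≤ a ^ gam * (Real.exp C * (b * mnorm (W (i + 1)))) := by
        have := (hy.rpow_bounds i).2.trans
          (mul_le_mul_of_nonneg_left (h2 (i + 1) (by omega)) hC.le)
        gcongr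
      _ = _ := by ring
  · calc mnorm (W (i + 1)) ≤ a * |(y (i + 1) 0 : ℝ)| := h1 _ (by omega)
      _ ≤ a * (Real.exp C * |(y i 0 : ℝ)| ^ gam) := by
        have := (hy.rpow_bounds i).1
        gcongr
      _ ≤ a * (Real.exp C * (b * mnorm (W i)) ^ gam) := by
        have := h2 i hi
        gcongr
      _ = _ := by
        rw [Real.mul_rpow hb.le (hpos i hi).le]
        ring
  · rw [← div_eq_mul_inv, div_le_iff₀ (hpos i hi)]
    linarith [one_le_abs_cast (hW.1 i hi).2, abs_det_le_mnorm_mul_xiNorm ξ (W i),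
      mul_comm (mnorm (W i)) (xiNorm ξ (W i))]
  · rw [← div_eq_mul_inv, le_div_iff₀ (hpos i hi)]
    calc xiNorm ξ (W i) * mnorm (W i)
        ≤ c * Real.exp (C - Real.log |(y i 0 : ℝ)|) * (a * |(y i 0 : ℝ)|) := by
          refine mul_le_mul ((h3 i hi).trans ?_) (h1 i hi) (hpos i hi).le (by positivity)
          exact mul_le_mul_of_nonneg_left (hy.err_le_exp i) hc.le
      _ = _ := by
        rw [Real.exp_sub, Real.exp_log (hy.abs_pos i)]
        field_simp [(hy.abs_pos i).ne']

lemma abs_det_sym_le (hy : IsFibPoints ξ C y) (k : ℕ) :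
    |((sym (y k)).det : ℝ)| ≤ (2 + 2 * |ξ|) * Real.exp C := by
  rw [det_sym]
  refine (abs_symDet_le (hy.ne_zero k) (hy.err_le_one k)).trans
    (mul_le_mul_of_nonneg_left ?_ (by positivity))
  calc _ ≤ |(y k 0 : ℝ)| * Real.exp (C - Real.log |(y k 0 : ℝ)|) :=
        mul_le_mul_of_nonneg_left (hy.err_le_exp k) (abs_nonneg _)
    _ = _ := by
      rw [Real.exp_sub, Real.exp_log (hy.abs_pos k), mul_div_cancel₀ _ (hy.abs_pos k).ne']

lemma isSymRec (hy : IsFibPoints ξ C y) (h : ∀ k, ∃ a b : ℤ, a ≠ 0 ∧ b ≠ 0 ∧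
    a • bracket (y (k + 2)) (y (k + 3)) = b • y k) : IsSymRec y where
  det_ne_zero k := by
    rw [det_sym]
    exact hy.symDet_ne_zero k
  par k := by
    obtain ⟨a, b, ha, hb, hab⟩ := h k
    exact ⟨a, b, ha, hb, by rw [← sym_bracket, smul_sym, hab, smul_sym]⟩

lemma not_par_sym (hy : IsFibPoints ξ C y) : ¬ Par (sym (y 3)) (sym (y 0)) := by
  rintro ⟨a, b, -, hb, h⟩
  rw [smul_sym, smul_sym] at h
  exact hy.not_proportional 0 hb (sym_injective h).symm

end IsFibPoints

/-- For each extremal real number ξ there exists an unbounded admissible Fibonacci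
sequence (W_i)_{i≥1} in 𝒫 which is associated to ξ. -/
theorem stmt0 (ξ : ℝ) (hξ : IsExtremal ξ) : ∃ W : ℕ → M2, IsAssociated ξ W := by
  obtain ⟨C, y, hy, hbr⟩ := hξ.exists_isFibPoints_bracket
  obtain ⟨N, W, hN, hN1, hN2, hW, hpar⟩ :=
    (hy.isSymRec hbr).exists_isFibP (hy.det3_ne_zero 0) hy.not_par_sym
  have hadm : AdmissibleFib W := by
    refine ⟨N, hN, hN1, hN2, fun i hi => ?_⟩
    have h := (hpar i hi).2.mul_right (alt N i)
    rw [Matrix.mul_assoc] at h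
    refine (h.trans (Par.mul_adjugate_mul_cancel ?_ _)).isSymm (sym_transpose _)
    rw [det_alt]
    exact hN.2
  have hbound := fun i hi => (hpar i hi).2.norm_bounds (ξ := ξ) (hpar i hi).1
    ((det_alt N i).trans_ne hN.2) (hy.ne_zero i) (hy.err_le_one i)
  simp only [mnorm_alt, det_alt] at hbound
  have hnN : 0 < mnorm N := by
    by_contra! h
    have h1 := abs_det_le_mnorm_mul_xiNorm ξ N
    have h2 := one_le_abs_cast hN.2
    nlinarith [xiNorm_nonneg ξ N]
  have hdN : 0 < |(N.det : ℝ)| := by linarith [one_le_abs_cast hN.2]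
  have hD := Real.exp_pos C
  refine ⟨W, hy.isAssociated_of_bounds hW hadm (a := 2 * (1 + |ξ| + ξ ^ 2) * mnorm N)
    (b := 2 * ((2 + 2 * |ξ|) * Real.exp C) * |(N.det : ℝ)| * mnorm N)
    (c := 2 * (1 + |ξ|) * mnorm N) (d := (2 + 2 * |ξ|) * Real.exp C * |(N.det : ℝ)|)
    (by positivity) (by positivity) (by positivity) (by positivity)
    (fun i hi => (hbound i hi).1) (fun i hi => (hbound i hi).2.1.trans ?_)
    (fun i hi => (hbound i hi).2.2.1) (fun i hi => (hbound i hi).2.2.2.trans ?_)⟩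
  · have := hy.abs_det_sym_le i
    have := mnorm_nonneg (W i)
    gcongr
  · have := hy.abs_det_sym_le i
    gcongr
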